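/- arXiv:math/0512499 — 11 statements merged into one kernel-verified Lean document; each statement's English description precedes it below -/
import Mathlib

section
/- Let (V,⋆) be an associative ℂ-algebra and let R, S : V → V be linear operators such that for all X, Y ∈ V: R(R(X)⋆Y + X⋆R(Y)) − R(X)⋆R(Y) − R(R(X⋆Y)) = S(X)⋆Y + X⋆S(Y) − S(X⋆Y). Then the bilinear multiplication X∘Y = R(X)⋆Y + X⋆R(Y) − R(X⋆Y) is associative and is compatible with ⋆. -/
/-- If operators `R`, `S` on an associative algebra `(V, ⋆)` satisfy the identity
`R(R(X)⋆Y + X⋆R(Y)) − R(X)⋆R(Y) − R²(X⋆Y) = S(X)⋆Y + X⋆S(Y) − S(X⋆Y)`, then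
`X∘Y = R(X)⋆Y + X⋆R(Y) − R(X⋆Y)` is associative and compatible with `⋆`. -/
theorem stmt_1 (V : Type*) [AddCommGroup V] [Module ℂ V]
    (ms : V →ₗ[ℂ] V →ₗ[ℂ] V)
    (hms : ∀ a b c : V, ms (ms a b) c = ms a (ms b c))
    (R S : V →ₗ[ℂ] V)
    (h : ∀ X Y : V,
      R (ms (R X) Y + ms X (R Y)) - ms (R X) (R Y) - R (R (ms X Y))
        = ms (S X) Y + ms X (S Y) - S (ms X Y))
    (mc : V → V → V)
    (hmc : ∀ X Y, mc X Y = ms (R X) Y + ms X (R Y) - R (ms X Y)) :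
    (∀ X Y Z, mc (mc X Y) Z = mc X (mc Y Z)) ∧
    (∀ (l : ℂ) (X Y Z : V),
      ms (ms X Y + l • mc X Y) Z + l • mc (ms X Y + l • mc X Y) Z
        = ms X (ms Y Z + l • mc Y Z) + l • mc X (ms Y Z + l • mc Y Z)) := by
  have assoc : ∀ X Y Z, mc (mc X Y) Z = mc X (mc Y Z) := by
    intro X Y Z
    have hl := congrArg (fun v => ms v Z) (h X Y)
    have hr := congrArg (fun v => ms X v) (h Y Z)
    have hXY := h (ms X Y) Z
    have hYZ := h X (ms Y Z)
    simp only [hmc, map_add, map_sub, LinearMap.add_apply, LinearMap.sub_apply, hms]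
      at hl hr hXY hYZ ⊢
    linear_combination (norm := module) hl - hr + hXY - hYZ
  refine ⟨assoc, fun l X Y Z => ?_⟩
  have hXYZ := assoc X Y Z
  simp only [hmc, map_add, map_sub, map_smul, LinearMap.add_apply, LinearMap.sub_apply,
    LinearMap.smul_apply, hms] at hXYZ ⊢
  linear_combination (norm := module) (l * l) • hXYZ
end

section
/- Let a, b ∈ Mat₂(ℂ). Then the bilinear multiplication on Mat₂(ℂ) given by X∘Y = (aX − Xa)(bY − Yb) (products being usual matrix products) is associative and is compatible with the usual matrix product. Moreover, if det a = 0, then the linear operator R(X) = a(Xb − bX) satisfies R(R(X)Y + XR(Y)) − R(X)R(Y) − R(R(XY)) = 0 for all X, Y ∈ Mat₂(ℂ). -/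
theorem Matrix.mul_commutator_fin_two {K : Type*} [CommRing K] (a X : Matrix (Fin 2) (Fin 2) K) :
    a * (a * X - X * a) = a.trace • (a * X - X * a) - (a * X - X * a) * a := by
  ext i j
  fin_cases i <;> fin_cases j <;>
    simp [Matrix.mul_apply, Fin.sum_univ_two, Matrix.trace] <;> ring

theorem Matrix.commutator_anticommutator_fin_two {K : Type*} [CommRing K]
    (a b Y : Matrix (Fin 2) (Fin 2) K) :
    a.trace • (b * Y - Y * b) - a * (b * Y - Y * b) - (b * Y - Y * b) * a
      = b * (a * Y - Y * a) + (a * Y - Y * a) * b - b.trace • (a * Y - Y * a) := by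
  ext i j
  fin_cases i <;> fin_cases j <;>
    simp [Matrix.mul_apply, Fin.sum_univ_two, Matrix.trace] <;> ring

theorem Matrix.mul_add_mul_swap_fin_two {K : Type*} [CommRing K] (a b : Matrix (Fin 2) (Fin 2) K) :
    a * b + b * a
      = a.trace • b + b.trace • a + ((a * b).trace - a.trace * b.trace) • 1 := by
  ext i j
  fin_cases i <;> fin_cases j <;>
    simp [Matrix.mul_apply, Fin.sum_univ_two, Matrix.trace] <;> ring

theorem Matrix.mul_self_of_det_eq_zero_fin_two {K : Type*} [CommRing K]
    {a : Matrix (Fin 2) (Fin 2) K} (ha : a.det = 0) : a * a = a.trace • a := by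
  rw [Matrix.det_fin_two] at ha
  ext i j
  fin_cases i <;> fin_cases j <;>
    simp [Matrix.mul_apply, Fin.sum_univ_two, Matrix.trace] <;>
    first | ring1 | linear_combination -ha

theorem Matrix.mul_mul_self_of_det_eq_zero_fin_two {K : Type*} [CommRing K]
    {a : Matrix (Fin 2) (Fin 2) K} (ha : a.det = 0) (b : Matrix (Fin 2) (Fin 2) K) :
    a * b * a = (a * b).trace • a := by
  have h := congrArg (a * ·) (Matrix.mul_add_mul_swap_fin_two a b)
  simp only [mul_add, ← mul_assoc, Matrix.mul_self_of_det_eq_zero_fin_two ha, Matrix.mul_smul,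
    Matrix.smul_mul, sub_smul, smul_smul, mul_sub, mul_one] at h
  linear_combination (norm := module) h

/-- For `a b ∈ Mat₂(ℂ)`, the multiplication `X∘Y = (aX − Xa)(bY − Yb)` is associative
and compatible with the usual matrix product; moreover if `det a = 0` then
`R(X) = a(Xb − bX)` satisfies `R(R(X)Y + XR(Y)) − R(X)R(Y) − R(R(XY)) = 0`. -/
theorem stmt_3 (a b : Matrix (Fin 2) (Fin 2) ℂ)
    (mc : Matrix (Fin 2) (Fin 2) ℂ → Matrix (Fin 2) (Fin 2) ℂ → Matrix (Fin 2) (Fin 2) ℂ)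
    (hmc : ∀ X Y, mc X Y = (a * X - X * a) * (b * Y - Y * b))
    (R : Matrix (Fin 2) (Fin 2) ℂ → Matrix (Fin 2) (Fin 2) ℂ)
    (hR : ∀ X, R X = a * (X * b - b * X)) :
    (∀ X Y Z, mc (mc X Y) Z = mc X (mc Y Z)) ∧
    (∀ (l : ℂ) (X Y Z : Matrix (Fin 2) (Fin 2) ℂ),
      (X * Y + l • mc X Y) * Z + l • mc (X * Y + l • mc X Y) Z
        = X * (Y * Z + l • mc Y Z) + l • mc X (Y * Z + l • mc Y Z)) ∧
    (a.det = 0 → ∀ X Y, R (R X * Y + X * R Y) - R X * R Y - R (R (X * Y)) = 0) := by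
  have hassoc : ∀ X Y Z, mc (mc X Y) Z = mc X (mc Y Z) := by
    intro X Y Z
    simp only [hmc]
    have h₁ := Matrix.mul_commutator_fin_two a X
    have h₂ := Matrix.mul_commutator_fin_two b Z
    have h := Matrix.commutator_anticommutator_fin_two a b Y
    generalize a * X - X * a = P at *
    generalize b * Z - Z * b = Q at *
    generalize b * Y - Y * b = S at *
    generalize a * Y - Y * a = T at *
    calc (a * (P * S) - P * S * a) * Q = (a * P * S - P * S * a) * Q := by noncomm_ring
      _ = P * (a.trace • S - a * S - S * a) * Q := by
        rw [h₁]
        simp only [sub_mul, mul_sub, Matrix.smul_mul, Matrix.mul_smul, mul_assoc]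
      _ = P * (b * (T * Q) - T * (b.trace • Q - b * Q)) := by
        rw [h]
        simp only [sub_mul, mul_sub, add_mul, mul_add, Matrix.smul_mul, Matrix.mul_smul, mul_assoc]
        abel
      _ = P * (b * (T * Q) - T * Q * b) := by rw [h₂, sub_sub_cancel, mul_assoc T]
  have hcompat : ∀ X Y Z, mc X Y * Z + mc (X * Y) Z = X * mc Y Z + mc X (Y * Z) := by
    intro X Y Z
    simp only [hmc]
    noncomm_ring
  refine ⟨hassoc, fun l X Y Z => ?_, fun ha X Y => ?_⟩
  · have hleft : mc (X * Y + l • mc X Y) Z = mc (X * Y) Z + l • mc (mc X Y) Z := by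
      simp only [hmc _ Z, mul_add, add_mul, Matrix.mul_smul, Matrix.smul_mul, smul_sub, sub_mul]
      abel
    have hright : mc X (Y * Z + l • mc Y Z) = mc X (Y * Z) + l • mc X (mc Y Z) := by
      simp only [hmc X, mul_add, add_mul, Matrix.mul_smul, Matrix.smul_mul, smul_sub, mul_sub]
      abel
    rw [hleft, hright, hassoc, add_mul, mul_add, Matrix.smul_mul, Matrix.mul_smul, mul_assoc X]
    linear_combination (norm := module) l • hcompat X Y Z
  · have haa := Matrix.mul_self_of_det_eq_zero_fin_two ha
    have haba := Matrix.mul_mul_self_of_det_eq_zero_fin_two ha b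
    have hanti := Matrix.mul_add_mul_swap_fin_two a b
    have hderiv : (Y * b - b * Y) * b - b * (Y * b - b * Y)
        = b.trace • (Y * b - b * Y) - 2 • (b * (Y * b - b * Y)) := by
      have h := Matrix.mul_commutator_fin_two b Y
      rw [← neg_sub (b * Y) (Y * b), neg_mul, mul_neg, smul_neg]
      linear_combination (norm := module) -h
    have hfactor : a * (X * (a * b - b * a) - (a * b - b * a) * X + b.trace • (X * a - a * X)
        - 2 • ((X * a - a * X) * b) - a * (X * b - b * X)) = 0 := by
      have h₁ : a * (X * (a * b - b * a) - (a * b - b * a) * X + b.trace • (X * a - a * X)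
          - 2 • ((X * a - a * X) * b) - a * (X * b - b * X))
          = -(a * X * (a * b + b * a)) + a * a * X * b + a * b * a * X
            + b.trace • (a * X * a) - b.trace • (a * a * X) := by
        simp only [mul_add, mul_sub, sub_mul, Matrix.mul_smul, mul_assoc, smul_sub]
        abel
      rw [h₁, hanti, haba, haa]
      simp only [mul_add, Matrix.mul_smul, Matrix.smul_mul, mul_one]
      module
    have hexpand : R (R X * Y + X * R Y) - R X * R Y - R (R (X * Y))
        = a * ((X * (a * b - b * a) - (a * b - b * a) * X) * (Y * b - b * Y)
          + (X * a - a * X) * ((Y * b - b * Y) * b - b * (Y * b - b * Y))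
          - a * (X * b - b * X) * (Y * b - b * Y)) := by
      simp only [hR]
      noncomm_ring
    rw [hexpand, hderiv]
    generalize Y * b - b * Y = S at *
    calc
      _ = a * (X * (a * b - b * a) - (a * b - b * a) * X + b.trace • (X * a - a * X)
          - 2 • ((X * a - a * X) * b) - a * (X * b - b * X)) * S := by
        simp only [sub_mul, add_mul, mul_sub, mul_add, smul_sub, Matrix.mul_smul,
          Matrix.smul_mul, mul_assoc]
        abel
      _ = 0 := by rw [hfactor, zero_mul]
end

section
/- Let m ≥ 1, let V = ℂ^m with basis e₁,…,e_m and the associative multiplication e_i⋆e_j = δ_{ij}e_i. Let (r_{ij})_{1≤i,j≤m} be complex numbers such that there exists q₀ ∈ ℂ with Σ_{k=1}^m r_{ki} = q₀ for every i, and r_{ik}r_{jk} = r_{ij}r_{jk} + r_{ji}r_{ik} for all pairwise distinct i, j, k. Then the bilinear multiplication on V defined by e_i∘e_j = r_{ij}e_j + r_{ji}e_i − δ_{ij}·Σ_{k=1}^m r_{ik}e_k is associative and compatible with ⋆. -/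
/-- Deforming the product of a commutative ring by an additive map `R` gives an associative product
`R x * y + x * R y - R (x * y)` as soon as the failure of `R` to be multiplicative is a
Hochschild coboundary. -/
theorem deformed_mul_assoc {A : Type*} [CommRing A] (R S : A →+ A) (mc : A → A → A)
    (hmc : ∀ x y, mc x y = R x * y + x * R y - R (x * y))
    (hS : ∀ x y, R x * R y - R (mc x y) = S x * y + x * S y - S (x * y)) (x y z : A) :
    mc (mc x y) z = mc x (mc y z) := by
  have hcocycle : x * mc y z + mc x (y * z) = mc x y * z + mc (x * y) z := by
    simp only [hmc, mul_assoc]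
    ring
  have hR := congrArg R hcocycle
  rw [map_add, map_add] at hR
  have h1 := hS x y
  have h2 := hS y z
  have h3 := hS x (y * z)
  have h4 := hS (x * y) z
  rw [mul_assoc x y z] at h4
  rw [hmc (mc x y) z, hmc x (mc y z)]
  have h5 := hmc x y
  have h6 := hmc y z
  linear_combination hR - z * h1 + x * h2 + h3 - h4 + R z * h5 - R x * h6

/-- The linear map `e_i ↦ ∑ k, r i k e_k`, as an additive map. -/
noncomputable def coeffMap {m : ℕ} (r : Fin m → Fin m → ℂ) : (Fin m → ℂ) →+ (Fin m → ℂ) where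
  toFun x k := ∑ i, r i k * x i
  map_zero' := by ext; simp
  map_add' x y := by ext; simp [mul_add, Finset.sum_add_distrib]

theorem coeffMap_apply {m : ℕ} (r : Fin m → Fin m → ℂ) (x : Fin m → ℂ) (k : Fin m) :
    coeffMap r x k = ∑ i, r i k * x i := rfl

/-- The coefficients of the cochain whose coboundary measures the failure of `coeffMap r` to be
multiplicative. -/
noncomputable def defectCoeff {m : ℕ} (r : Fin m → Fin m → ℂ) (i j : Fin m) : ℂ :=
  (if i = j then ∑ l, r i l * r l i else 0) - r i j * r j i

theorem sum_mul_eq_of_ne {m : ℕ} {r : Fin m → Fin m → ℂ} {q0 : ℂ}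
    (hsum : ∀ i, ∑ k, r k i = q0)
    (hrel : ∀ i j k : Fin m, i ≠ j → j ≠ k → i ≠ k →
      r i k * r j k = r i j * r j k + r j i * r i k)
    {i k : Fin m} (hik : i ≠ k) :
    ∑ l, r i l * r l k = r i k * r k i + 2 * (r i i * r i k) - r i k * r i k := by
  have key : ∀ l, r i l * r l k = r i k * (r l k - r l i)
      + ((if l = i then r i i * r i k - r i k * (r i k - r i i) else 0)
      + (if l = k then r i k * r k i else 0)) := by
    intro l
    by_cases h1 : l = i
    · subst h1
      simp [hik]
    · by_cases h2 : l = k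
      · subst h2
        simp [h1]
        ring
      · simp only [h1, h2, if_false]
        linear_combination -hrel i l k (Ne.symm h1) h2 hik
  rw [Finset.sum_congr rfl fun l _ => key l, Finset.sum_add_distrib, Finset.sum_add_distrib,
    ← Finset.mul_sum, Finset.sum_sub_distrib, hsum, hsum]
  simp
  ring

theorem structure_coeff_eq {m : ℕ} {r : Fin m → Fin m → ℂ} {q0 : ℂ}
    (hsum : ∀ i, ∑ k, r k i = q0)
    (hrel : ∀ i j k : Fin m, i ≠ j → j ≠ k → i ≠ k →
      r i k * r j k = r i j * r j k + r j i * r i k) (i j k : Fin m) :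
    r i k * r j k - r i j * r j k - r j i * r i k + (if i = j then ∑ l, r i l * r l k else 0)
      = (if j = k then defectCoeff r i k else 0) + (if i = k then defectCoeff r j k else 0)
        - (if i = j then defectCoeff r i k else 0) := by
  by_cases hij : i = j
  · subst hij
    by_cases hik : i = k
    · subst hik
      simp [defectCoeff]
      ring
    · simp only [hik, if_false, if_true, defectCoeff]
      rw [sum_mul_eq_of_ne hsum hrel hik]
      ring
  · by_cases hjk : j = k
    · subst hjk
      simp [defectCoeff, hij, mul_comm]
    · by_cases hik : i = k
      · subst hik
        simp [defectCoeff, hij, hjk]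
        ring
      · simp only [hij, hjk, hik, if_false]
        linear_combination hrel i j k hij hjk hik

theorem coeffMap_mul_sub {m : ℕ} {r : Fin m → Fin m → ℂ} {q0 : ℂ}
    (hsum : ∀ i, ∑ k, r k i = q0)
    (hrel : ∀ i j k : Fin m, i ≠ j → j ≠ k → i ≠ k →
      r i k * r j k = r i j * r j k + r j i * r i k) (x y : Fin m → ℂ) :
    coeffMap r x * coeffMap r y
        - coeffMap r (coeffMap r x * y + x * coeffMap r y - coeffMap r (x * y))
      = coeffMap (defectCoeff r) x * y + x * coeffMap (defectCoeff r) y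
        - coeffMap (defectCoeff r) (x * y) := by
  ext k
  have h : ∑ i, ∑ j, (r i k * r j k - r i j * r j k - r j i * r i k
        + (if i = j then ∑ l, r i l * r l k else 0)) * (x i * y j)
      = ∑ i, ∑ j, ((if j = k then defectCoeff r i k else 0)
        + (if i = k then defectCoeff r j k else 0)
        - (if i = j then defectCoeff r i k else 0)) * (x i * y j) := by
    simp only [structure_coeff_eq hsum hrel]
  have hR : coeffMap r x k * coeffMap r y k = ∑ i, ∑ j, r i k * r j k * (x i * y j) := by
    simp only [coeffMap_apply, Finset.sum_mul_sum]
    exact Finset.sum_congr rfl fun i _ => Finset.sum_congr rfl fun j _ => by ring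
  have hL : coeffMap r (coeffMap r x * y) k = ∑ i, ∑ j, r i j * r j k * (x i * y j) := by
    simp only [coeffMap_apply, Pi.mul_apply, Finset.sum_mul, Finset.mul_sum]
    rw [Finset.sum_comm]
    exact Finset.sum_congr rfl fun i _ => Finset.sum_congr rfl fun j _ => by ring
  have hM : coeffMap r (x * coeffMap r y) k = ∑ i, ∑ j, r j i * r i k * (x i * y j) := by
    simp only [coeffMap_apply, Pi.mul_apply, Finset.mul_sum]
    exact Finset.sum_congr rfl fun i _ => Finset.sum_congr rfl fun j _ => by ring
  have hN : coeffMap r (coeffMap r (x * y)) k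
      = ∑ i, (∑ l, r i l * r l k) * (x i * y i) := by
    simp only [coeffMap_apply, Pi.mul_apply, Finset.sum_mul, Finset.mul_sum]
    rw [Finset.sum_comm]
    exact Finset.sum_congr rfl fun i _ => Finset.sum_congr rfl fun j _ => by ring
  simp only [add_mul, sub_mul, Finset.sum_add_distrib, Finset.sum_sub_distrib, ite_mul, zero_mul,
    Finset.sum_ite_eq, Finset.sum_ite_eq', Finset.mem_univ, if_true] at h
  rw [Finset.sum_comm (f := fun i j => if i = k then defectCoeff r j k * (x i * y j) else 0)] at h
  simp only [Finset.sum_ite_eq', Finset.mem_univ, if_true] at h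
  rw [← hR, ← hL, ← hM, ← hN] at h
  simp only [map_add, map_sub, Pi.add_apply, Pi.sub_apply, Pi.mul_apply]
  have hX : coeffMap (defectCoeff r) x k * y k = ∑ i, defectCoeff r i k * (x i * y k) := by
    simp only [coeffMap_apply, Finset.sum_mul, mul_assoc]
  have hY : x k * coeffMap (defectCoeff r) y k = ∑ j, defectCoeff r j k * (x k * y j) := by
    simp only [coeffMap_apply, Finset.mul_sum, mul_left_comm]
  rw [hX, hY, coeffMap_apply (defectCoeff r) (x * y)]
  simp only [Pi.mul_apply]
  linear_combination h


/-- Example 1.3: the multiplication `e_i∘e_j = r_{ij}e_j + r_{ji}e_i − δ_{ij}Σ_k r_{ik}e_k`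
(written here in its bilinear extension to `ℂ^m`) is associative and compatible with
the multiplication `e_i⋆e_j = δ_{ij}e_i` (the pointwise product). -/
theorem stmt_5 (m : ℕ) (hm : 1 ≤ m) (r : Fin m → Fin m → ℂ)
    (q0 : ℂ) (hsum : ∀ i, ∑ k, r k i = q0)
    (hrel : ∀ i j k : Fin m, i ≠ j → j ≠ k → i ≠ k →
      r i k * r j k = r i j * r j k + r j i * r i k)
    (mc : (Fin m → ℂ) → (Fin m → ℂ) → (Fin m → ℂ))
    (hmc : ∀ x y k, mc x y k =
      (∑ i, r i k * x i) * y k + x k * (∑ j, r j k * y j) - ∑ i, r i k * x i * y i) :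
    (∀ x y z, mc (mc x y) z = mc x (mc y z)) ∧
    (∀ (l : ℂ) (x y z : Fin m → ℂ),
      (x * y + l • mc x y) * z + l • mc (x * y + l • mc x y) z
        = x * (y * z + l • mc y z) + l • mc x (y * z + l • mc y z)) := by
  have hmc' : ∀ x y, mc x y = coeffMap r x * y + x * coeffMap r y - coeffMap r (x * y) := by
    intro x y
    ext k
    simp only [hmc, Pi.add_apply, Pi.sub_apply, Pi.mul_apply, coeffMap_apply, mul_assoc]
  have hassoc : ∀ x y z, mc (mc x y) z = mc x (mc y z) :=
    deformed_mul_assoc (coeffMap r) (coeffMap (defectCoeff r)) mc hmc' fun x y => by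
      rw [hmc', coeffMap_mul_sub hsum hrel]
  refine ⟨hassoc, fun l x y z => ?_⟩
  have hsmul : ∀ (c : ℂ) (u : Fin m → ℂ), coeffMap r (c • u) = c • coeffMap r u := by
    intro c u
    ext k
    simp only [coeffMap_apply, Pi.smul_apply, smul_eq_mul, Finset.mul_sum, mul_left_comm]
  have hleft : mc (x * y + l • mc x y) z = mc (x * y) z + l • mc (mc x y) z := by
    simp only [hmc' _ z, map_add, add_mul, smul_mul_assoc, hsmul, smul_add, smul_sub]
    abel
  have hright : mc x (y * z + l • mc y z) = mc x (y * z) + l • mc x (mc y z) := by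
    simp only [hmc' x, map_add, mul_add, mul_smul_comm, hsmul, smul_add, smul_sub]
    abel
  have hcocycle : mc x y * z + mc (x * y) z = x * mc y z + mc x (y * z) := by
    simp only [hmc', mul_assoc]
    ring
  rw [hleft, hright, hassoc]
  simp only [add_mul, mul_add, smul_mul_assoc, mul_smul_comm, mul_assoc]
  linear_combination (norm := module) l • hcocycle
end

section
/- Let V be a complex vector space with compatible bilinear associative multiplications ⋆ and ∘, let m ≥ 1, and let q ∈ ℂ[u] be a polynomial of degree at most m. Let W = V ⊗ F_m where F_m is the space of polynomials in t of degree < m; write x_i = x ⊗ tⁱ, and for x ∈ V write x(u) = x₀ + x₁u + ⋯ + x_{m−1}u^{m−1} ∈ W[u]. For x, y ∈ V put P_{x,y}(w) = (x⋆y)(w) + w·(x∘y)(w) ∈ W[w]. Then for all x, y ∈ V the polynomial q(u)P_{x,y}(v) − q(v)P_{x,y}(u) ∈ W[u,v] is divisible by u − v and the quotient has degree at most m−1 in each of u and v; consequently there exists a unique bilinear multiplication · on W satisfying the identity x(u)·y(v) = (q(u)P_{x,y}(v) − q(v)P_{x,y}(u))/(u − v) of polynomials in u, v with coefficients in W, for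 all x, y ∈ V, and this multiplication · on W is associative. -/
open Finset in
/-- The coefficients of the quotient of `∑ G A B u^A v^B` by `u - v`. -/
def diffQuot {M : Type*} [AddCommGroup M] (G : ℕ → ℕ → M) (A B : ℕ) : M :=
  ∑ k ∈ range (B + 1), G (A + 1 + k) (B - k)

section diffQuot

open Finset

variable {M : Type*} [AddCommGroup M] {G : ℕ → ℕ → M}

theorem diffQuot_zero_right (A : ℕ) : diffQuot G A 0 = G (A + 1) 0 := by
  simp [diffQuot]

theorem diffQuot_succ_right (A B : ℕ) :
    diffQuot G A (B + 1) = G (A + 1) (B + 1) + diffQuot G (A + 1) B := by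
  rw [diffQuot, sum_range_succ', add_comm, diffQuot]
  congr 1
  refine sum_congr rfl fun k _ => ?_
  congr 1 <;> omega

theorem diffQuot_spec (hG : ∀ N, ∑ k ∈ range (N + 1), G k (N - k) = 0) (A B : ℕ) :
    G A B = (if A = 0 then 0 else diffQuot G (A - 1) B)
      - (if B = 0 then 0 else diffQuot G A (B - 1)) := by
  rcases A with _ | A <;> rcases B with _ | B
  · simpa using hG 0
  · have h := hG (B + 1)
    rw [sum_range_succ'] at h
    simp only [diffQuot, if_true, Nat.add_one_sub_one, zero_sub, Nat.add_eq_zero_iff, one_ne_zero,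
      and_false, if_false]
    rw [eq_neg_iff_add_eq_zero, add_comm, ← h]
    congr 1
    refine sum_congr rfl fun k _ => ?_
    congr 1 <;> omega
  · simp [diffQuot_zero_right]
  · simp [diffQuot_succ_right]

theorem diffQuot_eq_zero (hG : ∀ N, ∑ k ∈ range (N + 1), G k (N - k) = 0) {m : ℕ}
    (hm : ∀ A B, m < A ∨ m < B → G A B = 0) {A B : ℕ} (h : m ≤ A ∨ m ≤ B) :
    diffQuot G A B = 0 := by
  by_cases hA : m ≤ A
  · exact sum_eq_zero fun k _ => hm _ _ (Or.inl (by omega))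
  · have hB : m ≤ B := h.resolve_left hA
    have h0 := hG (A + 1 + B)
    rw [add_assoc, sum_range_add, sum_eq_zero, zero_add] at h0
    · rw [← h0]
      refine sum_congr rfl fun k _ => ?_
      congr 1
      omega
    · intro k hk
      exact hm _ _ (Or.inr (by rw [mem_range] at hk; omega))

theorem eq_diffQuot {Q : ℕ → ℕ → M}
    (hQ : ∀ A B, G A B = (if A = 0 then 0 else Q (A - 1) B) - (if B = 0 then 0 else Q A (B - 1)))
    (A B : ℕ) : Q A B = diffQuot G A B := by
  induction B generalizing A with
  | zero => simp [diffQuot_zero_right, hQ (A + 1) 0]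
  | succ B ih => simp [diffQuot_succ_right, hQ (A + 1) (B + 1), ← ih]

theorem sub_smul_sum_quot {R : Type*} [CommRing R] [Module R M] {Q : ℕ → ℕ → M} {m : ℕ}
    (hm : ∀ A B, m ≤ A ∨ m ≤ B → Q A B = 0)
    (hQ : ∀ A B, G A B = (if A = 0 then 0 else Q (A - 1) B) - (if B = 0 then 0 else Q A (B - 1)))
    (u v : R) :
    (u - v) • ∑ A ∈ range m, ∑ B ∈ range m, (u ^ A * v ^ B) • Q A B
      = ∑ A ∈ range (m + 1), ∑ B ∈ range (m + 1), (u ^ A * v ^ B) • G A B := by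
  simp only [hQ, smul_sub, sum_sub_distrib, sub_smul]
  congr 1
  · rw [sum_range_succ' _ m]
    simp only [Nat.add_eq_zero_iff, one_ne_zero, and_false, if_false, if_true, smul_zero,
      sum_const_zero, add_zero, Nat.add_one_sub_one, smul_sum]
    refine sum_congr rfl fun A _ => ?_
    rw [sum_range_succ, hm A m (Or.inr le_rfl), smul_zero, add_zero]
    refine sum_congr rfl fun B _ => ?_
    rw [smul_smul]
    congr 1
    ring
  · rw [sum_range_succ]
    rw [sum_eq_zero (s := range (m + 1)) (f := fun B => (u ^ m * v ^ B) • _), add_zero, smul_sum]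
    · refine sum_congr rfl fun A _ => ?_
      rw [sum_range_succ' _ m]
      simp only [Nat.add_eq_zero_iff, one_ne_zero, and_false, if_false, if_true, smul_zero,
        add_zero, Nat.add_one_sub_one, smul_sum]
      refine sum_congr rfl fun B _ => ?_
      rw [smul_smul]
      congr 1
      ring
    · intro B _
      rw [hm m (B - 1) (Or.inl le_rfl), ite_self, smul_zero]

end diffQuot

section genFun

variable {V : Type*} [AddCommGroup V] [Module ℂ V] {m : ℕ}

/-- The value at `w` of the generating function `x(u) = ∑ xᵢ uⁱ`. -/
def genFun (m : ℕ) (w : ℂ) : V →ₗ[ℂ] (Fin m → V) :=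
  LinearMap.pi fun i => w ^ (i : ℕ) • LinearMap.id

theorem genFun_apply (w : ℂ) (x : V) (i : Fin m) : genFun m w x i = w ^ (i : ℕ) • x := rfl

theorem genFun_eq_sum (w : ℂ) (x : V) :
    genFun m w x = ∑ i : Fin m, w ^ (i : ℕ) • Pi.single i x := by
  ext j
  simp [genFun_apply, Finset.sum_apply, Pi.single_apply]

/-- A linear map vanishing on generating functions at `m` distinct points is zero. -/
theorem linearMap_ext_genFun {N : Type*} [AddCommGroup N] [Module ℂ N]
    {f g : (Fin m → V) →ₗ[ℂ] N} {a : Fin m → ℂ} (ha : Function.Injective a)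
    (h : ∀ k x, f (genFun m (a k) x) = g (genFun m (a k) x)) : f = g := by
  have hdet : IsUnit (Matrix.vandermonde a).det :=
    isUnit_iff_ne_zero.2 (Matrix.det_vandermonde_ne_zero_iff.2 ha)
  have hinv := Matrix.nonsing_inv_mul _ hdet
  have hsingle (i : Fin m) (x : V) :
      Pi.single i x = ∑ k, (Matrix.vandermonde a)⁻¹ i k • genFun m (a k) x := by
    ext j
    have hij := congrFun (congrFun hinv i) j
    rw [Matrix.mul_apply] at hij
    simp only [Matrix.vandermonde_apply] at hij
    simp only [Finset.sum_apply, Pi.smul_apply, genFun_apply, smul_smul]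
    rw [← Finset.sum_smul, hij, Matrix.one_apply, Pi.single_apply]
    by_cases hh : i = j <;> simp [hh, eq_comm]
  refine LinearMap.pi_ext fun i x => ?_
  simp only [hsingle, map_sum, map_smul, h]

theorem assoc_of_genFun_rule {ms mc : V →ₗ[ℂ] V →ₗ[ℂ] V}
    (hms : ∀ a b c : V, ms (ms a b) c = ms a (ms b c))
    (hmc : ∀ a b c : V, mc (mc a b) c = mc a (mc b c))
    (hmix : ∀ a b c : V,
      mc (ms a b) c = mc a (ms b c) + ms a (mc b c) - ms (mc a b) c)
    (q : ℂ → ℂ) {mult : (Fin m → V) →ₗ[ℂ] (Fin m → V) →ₗ[ℂ] (Fin m → V)}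
    (hmult : ∀ (u v : ℂ) (x y : V), (u - v) • mult (genFun m u x) (genFun m v y)
      = q u • genFun m v (ms x y + v • mc x y) - q v • genFun m u (ms x y + u • mc x y))
    (X Y Z : Fin m → V) : mult (mult X Y) Z = mult X (mult Y Z) := by
  have key {u v w : ℂ} (huv : u ≠ v) (hvw : v ≠ w) (huw : u ≠ w) (x y z : V) :
      mult (mult (genFun m u x) (genFun m v y)) (genFun m w z)
        = mult (genFun m u x) (mult (genFun m v y) (genFun m w z)) := by
    have h1 := congrArg (fun t => mult t (genFun m w z)) (hmult u v x y)
    have h2 := congrArg (fun t => mult (genFun m u x) t) (hmult v w y z)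
    have h3 := hmult v w (ms x y + v • mc x y) z
    have h4 := hmult u w (ms x y + u • mc x y) z
    have h5 := hmult u w x (ms y z + w • mc y z)
    have h6 := hmult u v x (ms y z + v • mc y z)
    have hne : (u - v) * (v - w) * (u - w) ≠ 0 :=
      mul_ne_zero (mul_ne_zero (sub_ne_zero.2 huv) (sub_ne_zero.2 hvw)) (sub_ne_zero.2 huw)
    refine smul_right_injective _ hne ?_
    simp only [map_add, map_sub, map_smul, LinearMap.add_apply, LinearMap.sub_apply,
      LinearMap.smul_apply, smul_add, hms, hmc, hmix] at h1 h2 h3 h4 h5 h6 ⊢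
    linear_combination (norm := module) ((v - w) * (u - w)) • h1 - ((u - v) * (u - w)) • h2
      + (q u * (u - w)) • h3 - (q v * (v - w)) • h4 - (q v * (u - v)) • h5
      + (q w * (u - w)) • h6
  let a (r : ℕ) (k : Fin m) : ℂ := ((3 * (k : ℕ) + r : ℕ) : ℂ)
  have ha (r : ℕ) : Function.Injective (a r) := fun i j hij => by
    have := Nat.cast_injective hij
    exact Fin.ext (by omega)
  have hne {r s : ℕ} (hr : r < 3) (hs : s < 3) (hrs : r ≠ s) (i j : Fin m) : a r i ≠ a s j :=
    fun hij => by
      have := Nat.cast_injective hij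
      omega
  have h1 (j k : Fin m) (y z : V) :
      (mult.flip (genFun m (a 2 k) z)) ∘ₗ (mult.flip (genFun m (a 1 j) y))
        = mult.flip (mult (genFun m (a 1 j) y) (genFun m (a 2 k) z)) :=
    linearMap_ext_genFun (ha 0) fun i x => key (hne (by omega) (by omega) (by omega) i j)
      (hne (by omega) (by omega) (by omega) j k) (hne (by omega) (by omega) (by omega) i k) x y z
  have h2 (X : Fin m → V) (k : Fin m) (z : V) :
      (mult.flip (genFun m (a 2 k) z)) ∘ₗ (mult X)
        = (mult X) ∘ₗ (mult.flip (genFun m (a 2 k) z)) :=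
    linearMap_ext_genFun (ha 1) fun j y => LinearMap.congr_fun (h1 j k y z) X
  have h3 : mult (mult X Y) = (mult X) ∘ₗ (mult Y) :=
    linearMap_ext_genFun (ha 2) fun k z => LinearMap.congr_fun (h2 X k z) Y
  exact LinearMap.congr_fun h3 Z

end genFun


/-- Theorem 1.1: generating-function construction.  `W = V ⊗ F_m` is modelled as
`Fin m → V` (coefficient `i` corresponding to `x ⊗ tⁱ`), so that `x(u)` has
`u^A`-coefficient `Pi.single A x` for `A < m` and `0` otherwise.  `P x y` lists the
coefficients of `P_{x,y}(w) = (x⋆y)(w) + w·(x∘y)(w)`, and the coefficient of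
`u^A v^B` in `q(u)P_{x,y}(v) − q(v)P_{x,y}(u)` is
`q.coeff A • P x y B − q.coeff B • P x y A`.  Divisibility by `u − v` with quotient
`Q` reads coefficientwise as `G A B = Q (A−1) B − Q A (B−1)` (terms with negative
index omitted); the degree bound in each variable is `Q A B = 0` for `A ≥ m` or
`B ≥ m`.  The theorem: the quotient exists, there is a unique bilinear
multiplication on `W` whose coefficients realize it, and this multiplication is
associative. -/
theorem stmt_6 (V : Type*) [AddCommGroup V] [Module ℂ V]
    (m : ℕ) (hm : 1 ≤ m)
    (ms mc : V →ₗ[ℂ] V →ₗ[ℂ] V)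
    (hms : ∀ a b c : V, ms (ms a b) c = ms a (ms b c))
    (hmc : ∀ a b c : V, mc (mc a b) c = mc a (mc b c))
    (hcompat : ∀ (l : ℂ) (a b c : V),
      ms (ms a b + l • mc a b) c + l • mc (ms a b + l • mc a b) c
        = ms a (ms b c + l • mc b c) + l • mc a (ms b c + l • mc b c))
    (q : Polynomial ℂ) (hq : q.natDegree ≤ m)
    (P : V → V → ℕ → (Fin m → V))
    (hP : ∀ x y k, P x y k =
      (if h : k < m then Pi.single (⟨k, h⟩ : Fin m) (ms x y) else 0)
      + (if h : 1 ≤ k ∧ k ≤ m then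
          Pi.single (⟨k - 1, by omega⟩ : Fin m) (mc x y) else 0)) :
    (∀ x y : V, ∃ Q : ℕ → ℕ → (Fin m → V),
      (∀ A B, (m ≤ A ∨ m ≤ B) → Q A B = 0) ∧
      (∀ A B, q.coeff A • P x y B - q.coeff B • P x y A
        = (if A = 0 then 0 else Q (A - 1) B) - (if B = 0 then 0 else Q A (B - 1)))) ∧
    (∃! mult : (Fin m → V) →ₗ[ℂ] (Fin m → V) →ₗ[ℂ] (Fin m → V),
      ∀ (x y : V) (Q : ℕ → ℕ → (Fin m → V)),
        (∀ A B, (m ≤ A ∨ m ≤ B) → Q A B = 0) →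
        (∀ A B, q.coeff A • P x y B - q.coeff B • P x y A
          = (if A = 0 then 0 else Q (A - 1) B) - (if B = 0 then 0 else Q A (B - 1))) →
        ∀ i j : Fin m, mult (Pi.single i x) (Pi.single j y) = Q (i : ℕ) (j : ℕ)) ∧
    (∀ mult : (Fin m → V) →ₗ[ℂ] (Fin m → V) →ₗ[ℂ] (Fin m → V),
      (∀ (x y : V) (Q : ℕ → ℕ → (Fin m → V)),
        (∀ A B, (m ≤ A ∨ m ≤ B) → Q A B = 0) →
        (∀ A B, q.coeff A • P x y B - q.coeff B • P x y A
          = (if A = 0 then 0 else Q (A - 1) B) - (if B = 0 then 0 else Q A (B - 1))) →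
        ∀ i j : Fin m, mult (Pi.single i x) (Pi.single j y) = Q (i : ℕ) (j : ℕ)) →
      ∀ X Y Z, mult (mult X Y) Z = mult X (mult Y Z)) := by
  have hP' (x y : V) (k : ℕ) (i : Fin m) : P x y k i
      = (if k = i then ms x y else 0) + (if k = i + 1 then mc x y else 0) := by
    have := i.2
    rw [hP, Pi.add_apply]
    congr 1
    · split_ifs <;> simp_all [Fin.ext_iff]
    · split_ifs <;> simp_all [Pi.single_apply, Fin.ext_iff]; omega
  have hadd_left (x x' y : V) (k : ℕ) : P (x + x') y k = P x y k + P x' y k := by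
    ext i
    simp only [hP', Pi.add_apply, map_add, LinearMap.add_apply]
    split_ifs <;> module
  have hadd_right (x y y' : V) (k : ℕ) : P x (y + y') k = P x y k + P x y' k := by
    ext i
    simp only [hP', Pi.add_apply, map_add]
    split_ifs <;> module
  have hsmul_left (c : ℂ) (x y : V) (k : ℕ) : P (c • x) y k = c • P x y k := by
    ext i
    simp only [hP', Pi.smul_apply, map_smul, LinearMap.smul_apply]
    split_ifs <;> module
  have hsmul_right (c : ℂ) (x y : V) (k : ℕ) : P x (c • y) k = c • P x y k := by
    ext i
    simp only [hP', Pi.smul_apply, map_smul]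
    split_ifs <;> module
  let G (x y : V) (A B : ℕ) : Fin m → V := q.coeff A • P x y B - q.coeff B • P x y A
  have hGsum (x y : V) (N : ℕ) : ∑ k ∈ Finset.range (N + 1), G x y k (N - k) = 0 := by
    simp only [G, Finset.sum_sub_distrib]
    rw [sub_eq_zero, ← Finset.sum_range_reflect]
    refine Finset.sum_congr rfl fun k hk => ?_
    rw [Finset.mem_range] at hk
    congr 2; omega
  have hq0 {k : ℕ} (hk : m < k) : q.coeff k = 0 :=
    Polynomial.coeff_eq_zero_of_natDegree_lt (hq.trans_lt hk)
  have hP0 (x y : V) {k : ℕ} (hk : m < k) : P x y k = 0 := by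
    ext i
    have := i.2
    rw [hP', if_neg (by omega), if_neg (by omega), add_zero, Pi.zero_apply]
  have hG0 (x y : V) (A B : ℕ) (h : m < A ∨ m < B) : G x y A B = 0 := by
    rcases h with h | h <;> simp [G, hq0 h, hP0 x y h]
  have hex (x y : V) : ∃ Q : ℕ → ℕ → (Fin m → V),
      (∀ A B, (m ≤ A ∨ m ≤ B) → Q A B = 0) ∧
      (∀ A B, q.coeff A • P x y B - q.coeff B • P x y A
        = (if A = 0 then 0 else Q (A - 1) B) - (if B = 0 then 0 else Q A (B - 1))) :=
    ⟨diffQuot (G x y), fun _ _ h => diffQuot_eq_zero (hGsum x y) (hG0 x y) h,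
      diffQuot_spec (hGsum x y)⟩
  refine ⟨hex, ?_, ?_⟩
  · let D (A B : ℕ) : V →ₗ[ℂ] V →ₗ[ℂ] (Fin m → V) :=
      LinearMap.mk₂ ℂ (fun x y => diffQuot (G x y) A B)
        (fun x x' y => by
          simp only [diffQuot, G, hadd_left, ← Finset.sum_add_distrib]
          exact Finset.sum_congr rfl fun _ _ => by module)
        (fun c x y => by
          simp only [diffQuot, G, hsmul_left, Finset.smul_sum]
          exact Finset.sum_congr rfl fun _ _ => by module)
        (fun x y y' => by
          simp only [diffQuot, G, hadd_right, ← Finset.sum_add_distrib]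
          exact Finset.sum_congr rfl fun _ _ => by module)
        (fun c x y => by
          simp only [diffQuot, G, hsmul_right, Finset.smul_sum]
          exact Finset.sum_congr rfl fun _ _ => by module)
    refine ⟨∑ i : Fin m, ∑ j : Fin m,
      (D i j).compl₁₂ (LinearMap.proj i) (LinearMap.proj j), ?_, ?_⟩
    · intro x y Q _ hQ i j
      rw [eq_diffQuot (G := G x y) hQ]
      simp only [LinearMap.sum_apply, LinearMap.compl₁₂_apply, LinearMap.proj_apply]
      rw [Finset.sum_eq_single i, Finset.sum_eq_single j]
      · simp [D]
      · intro b _ hb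
        simp [hb]
      · simp
      · intro b _ hb
        simp [hb]
      · simp
    · intro mult hmult
      refine LinearMap.pi_ext fun i x => LinearMap.pi_ext fun j y => ?_
      obtain ⟨Q, hQ0, hQ⟩ := hex x y
      rw [hmult x y Q hQ0 hQ, eq_diffQuot (G := G x y) hQ]
      simp only [LinearMap.sum_apply, LinearMap.compl₁₂_apply, LinearMap.proj_apply]
      rw [Finset.sum_eq_single i, Finset.sum_eq_single j]
      · simp [D]
      · intro b _ hb
        simp [hb]
      · simp
      · intro b _ hb
        simp [hb]
      · simp
  · intro mult hmult
    have hmix (a b c : V) :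
        mc (ms a b) c = mc a (ms b c) + ms a (mc b c) - ms (mc a b) c := by
      have h := hcompat 1 a b c
      simp only [one_smul, map_add, LinearMap.add_apply, hms, hmc] at h
      linear_combination (norm := module) h
    have hPsum (x y : V) (w : ℂ) : ∑ k ∈ Finset.range (m + 1), w ^ k • P x y k
        = genFun m w (ms x y + w • mc x y) := by
      ext i
      have := i.2
      simp only [Finset.sum_apply, Pi.smul_apply, hP', smul_add, Finset.sum_add_distrib,
        smul_ite, smul_zero, Finset.sum_ite_eq', Finset.mem_range, genFun_apply, smul_smul]
      rw [if_pos (by omega), if_pos (by omega), pow_succ]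
    have hqsum (w : ℂ) : q.eval w = ∑ k ∈ Finset.range (m + 1), q.coeff k * w ^ k :=
      Polynomial.eval_eq_sum_range' (by omega) w
    refine assoc_of_genFun_rule hms hmc hmix (fun w => q.eval w) fun u v x y => ?_
    obtain ⟨Q, hQ0, hQ⟩ := hex x y
    have hval : mult (genFun m u x) (genFun m v y)
        = ∑ A ∈ Finset.range m, ∑ B ∈ Finset.range m, (u ^ A * v ^ B) • Q A B := by
      simp only [genFun_eq_sum, map_sum, map_smul, LinearMap.sum_apply, LinearMap.smul_apply,
        hmult x y Q hQ0 hQ, Finset.sum_range, Finset.smul_sum, smul_smul]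
      rw [Finset.sum_comm]
      simp only [mul_comm]
    rw [hval, sub_smul_sum_quot (G := G x y) hQ0 hQ u v]
    simp only [← hPsum, hqsum, G, smul_sub, Finset.sum_sub_distrib]
    congr 1
    · rw [Finset.sum_smul]
      refine Finset.sum_congr rfl fun A _ => ?_
      rw [Finset.smul_sum]
      exact Finset.sum_congr rfl fun B _ => by module
    · rw [Finset.sum_comm, Finset.sum_smul]
      refine Finset.sum_congr rfl fun B _ => ?_
      rw [Finset.smul_sum]
      exact Finset.sum_congr rfl fun A _ => by module
end

section
/- Let V, ⋆, ∘, m, q, W and the associative multiplication · on W = V ⊗ F_m be as in the generating-function construction, and assume q has degree exactly m with m pairwise distinct roots b₁,…,b_m. For each i let V_i denote the (possibly nonunital) associative ℂ-algebra whose underlying space is V with multiplication x•_iy = x⋆y + b_i·(x∘y). Then the ℂ-algebra (W, ·) is isomorphic to the direct product V₁ × ⋯ × V_m. -/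
open Polynomial in
theorem Polynomial.coeff_divByMonic_X_sub_C_of_isRoot {R : Type*} [CommRing R]
    {q : R[X]} {b : R} (h : q.IsRoot b) (A : ℕ) :
    q.coeff A = (if A = 0 then 0 else (q /ₘ (X - C b)).coeff (A - 1))
      - b * (q /ₘ (X - C b)).coeff A := by
  have key := mul_divByMonic_eq_iff_isRoot.2 h
  conv_lhs => rw [← key]
  rw [sub_mul, coeff_sub, coeff_C_mul]
  cases A <;> simp [coeff_X_mul]

/-- An antisymmetric array of coefficients supported on `[0, m] × [0, m]` is divisible by `u - v`,
with a quotient supported on `[0, m) × [0, m)`. -/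
theorem exists_quotient_by_sub {M : Type*} [AddCommGroup M] (m : ℕ) (R : ℕ → ℕ → M)
    (hsum : ∀ n, ∑ i ∈ Finset.range (n + 1), R (n - i) i = 0)
    (hR : ∀ A B, (m < A ∨ m < B) → R A B = 0) :
    ∃ Q : ℕ → ℕ → M, (∀ A B, (m ≤ A ∨ m ≤ B) → Q A B = 0) ∧
      ∀ A B, R A B = (if A = 0 then 0 else Q (A - 1) B) - (if B = 0 then 0 else Q A (B - 1)) := by
  refine ⟨fun A B => ∑ i ∈ Finset.range (B + 1), R (A + 1 + B - i) i, ?_, ?_⟩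
  · rintro A B (h | h)
    · refine Finset.sum_eq_zero fun i hi => hR _ _ (Or.inl ?_)
      have := Finset.mem_range.1 hi
      omega
    · have h1 := hsum (A + 1 + B)
      rw [show A + 1 + B + 1 = (B + 1) + (A + 1) by ring, Finset.sum_range_add] at h1
      rw [← h1, left_eq_add]
      exact Finset.sum_eq_zero fun i _ => hR _ _ (Or.inr (by omega))
  · intro A B
    rcases A with _ | A
    · rcases B with _ | B
      · simpa using hsum 0
      · have h1 := hsum (B + 1)
        rw [Finset.sum_range_succ] at h1
        simp only [Nat.sub_self] at h1
        simp only [if_true, Nat.add_one_ne_zero, if_false, Nat.add_sub_cancel, zero_sub, zero_add]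
        rw [Nat.add_comm 1 B]
        exact eq_neg_of_add_eq_zero_right h1
    · rcases B with _ | B
      · simp
      · simp only [Nat.add_one_ne_zero, if_false, Nat.add_sub_cancel]
        rw [Finset.sum_range_succ, show A + 1 + (B + 1) = A + 1 + 1 + B by ring]
        rw [show A + 1 + 1 + B - (B + 1) = A + 1 by omega]
        abel

/-- The linear automorphism of `ι → V` given by an invertible matrix of scalars. -/
theorem Matrix.exists_linearEquiv_sum_smul {K V ι : Type*} [Field K] [AddCommGroup V] [Module K V]
    [Fintype ι] [DecidableEq ι] (M : Matrix ι ι K) (hM : M.det ≠ 0) :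
    ∃ f : (ι → V) ≃ₗ[K] (ι → V), ∀ Z k, f Z k = ∑ i, M k i • Z i := by
  let F : Matrix ι ι K → (ι → V) →ₗ[K] (ι → V) := fun N =>
    LinearMap.pi fun k => ∑ i, N k i • LinearMap.proj i
  have hF : ∀ N Z k, F N Z k = ∑ i, N k i • Z i := fun N Z k => by simp [F]
  have hcomp : ∀ N N' : Matrix ι ι K, N * N' = 1 → F N ∘ₗ F N' = LinearMap.id := by
    intro N N' h
    refine LinearMap.ext fun Z => funext fun k => ?_
    simp only [LinearMap.comp_apply, hF, Finset.smul_sum, smul_smul, LinearMap.id_apply]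
    rw [Finset.sum_comm]
    simp only [← Finset.sum_smul, ← Matrix.mul_apply, h, Matrix.one_apply, ite_smul, one_smul,
      zero_smul, Finset.sum_ite_eq, Finset.mem_univ, if_true]
  have hu : IsUnit M.det := isUnit_iff_ne_zero.2 hM
  exact ⟨LinearEquiv.ofLinearMap (F M) (F M⁻¹) (hcomp _ _ (M.mul_nonsing_inv hu))
    (hcomp _ _ (M.nonsing_inv_mul hu)), hF M⟩

/-- Synthetic division with coefficients in a module: a finitely supported solution of the
recurrence satisfied by the coefficients of `q / (X - b)` is a multiple of these coefficients. -/
theorem eq_coeff_divByMonic_smul {K M : Type*} [Field K] [AddCommGroup M] [Module K M]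
    {q : Polynomial K} {b : K} (hb : q.IsRoot b) (m : ℕ) (hdeg : q.natDegree ≤ m) (p : M)
    (T : ℕ → M) (hT : ∀ A, m ≤ A → T A = 0)
    (hrec : ∀ A, q.coeff (A + 1) • p = T A - b • T (A + 1)) (A : ℕ) :
    T A = (q /ₘ (Polynomial.X - Polynomial.C b)).coeff A • p := by
  by_cases hA : m ≤ A
  · rw [hT A hA]
    rcases eq_or_ne q 0 with rfl | hq
    · simp
    rw [Polynomial.coeff_eq_zero_of_natDegree_lt, zero_smul]
    rw [Polynomial.natDegree_divByMonic _ (Polynomial.monic_X_sub_C b), Polynomial.natDegree_X_sub_C]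
    have := Polynomial.natDegree_pos_iff_degree_pos.2 (Polynomial.degree_pos_of_root hq hb)
    omega
  · have ih := eq_coeff_divByMonic_smul hb m hdeg p T hT hrec (A + 1)
    have h1 := hrec A
    have h2 := Polynomial.coeff_divByMonic_X_sub_C_of_isRoot hb (A + 1)
    simp only [Nat.add_one_ne_zero, if_false, Nat.add_sub_cancel] at h2
    rw [ih, h2, sub_smul, mul_smul] at h1
    exact (sub_left_inj.1 h1).symm
termination_by m - A


/-- Remark 2 after Theorem 1.1: if `q` has degree exactly `m` with pairwise distinct
roots `b₁,…,b_m`, then the algebra `(W, ·)` of the generating-function construction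
(modelled as in the previous statement, `W = Fin m → V`) is isomorphic to the direct
product of the algebras `(V, •ᵢ)` with `x •ᵢ y = x⋆y + bᵢ·(x∘y)`. -/
theorem stmt_7 (V : Type*) [AddCommGroup V] [Module ℂ V]
    (m : ℕ) (hm : 1 ≤ m)
    (ms mc : V →ₗ[ℂ] V →ₗ[ℂ] V)
    (hms : ∀ a b c : V, ms (ms a b) c = ms a (ms b c))
    (hmc : ∀ a b c : V, mc (mc a b) c = mc a (mc b c))
    (hcompat : ∀ (l : ℂ) (a b c : V),
      ms (ms a b + l • mc a b) c + l • mc (ms a b + l • mc a b) c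
        = ms a (ms b c + l • mc b c) + l • mc a (ms b c + l • mc b c))
    (q : Polynomial ℂ) (hq : q ≠ 0) (hqdeg : q.natDegree = m)
    (b : Fin m → ℂ) (hbinj : Function.Injective b) (hroot : ∀ i, q.IsRoot (b i))
    (P : V → V → ℕ → (Fin m → V))
    (hP : ∀ x y k, P x y k =
      (if h : k < m then Pi.single (⟨k, h⟩ : Fin m) (ms x y) else 0)
      + (if h : 1 ≤ k ∧ k ≤ m then
          Pi.single (⟨k - 1, by omega⟩ : Fin m) (mc x y) else 0))
    (mult : (Fin m → V) →ₗ[ℂ] (Fin m → V) →ₗ[ℂ] (Fin m → V))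
    (hmult : ∀ (x y : V) (Q : ℕ → ℕ → (Fin m → V)),
      (∀ A B, (m ≤ A ∨ m ≤ B) → Q A B = 0) →
      (∀ A B, q.coeff A • P x y B - q.coeff B • P x y A
        = (if A = 0 then 0 else Q (A - 1) B) - (if B = 0 then 0 else Q A (B - 1))) →
      ∀ i j : Fin m, mult (Pi.single i x) (Pi.single j y) = Q (i : ℕ) (j : ℕ)) :
    ∃ e : (Fin m → V) ≃ₗ[ℂ] (Fin m → V),
      ∀ X Y i, e (mult X Y) i = ms (e X i) (e Y i) + b i • mc (e X i) (e Y i) := by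
  have hP0 : ∀ x y k, m < k → P x y k = 0 := fun x y k hk => by
    rw [hP, dif_neg (by omega), dif_neg (by omega), add_zero]
  -- the value of the polynomial `x(u)` of `W[u]` at a scalar `u`
  let ev : ℂ → V → (Fin m → V) := fun u x k => u ^ (k : ℕ) • x
  have hev : ∀ u x, ev u x = ∑ k : Fin m, u ^ (k : ℕ) • (Pi.single k x : Fin m → V) := by
    intro u x
    funext k
    simp [ev, Finset.sum_apply, Pi.single_apply]
  have hPev : ∀ u x y, ∑ k ∈ Finset.range (m + 1), u ^ k • P x y k
      = ev u (ms x y + u • mc x y) := by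
    intro u x y
    have h1 : ∀ z, ∑ k ∈ Finset.range m, u ^ k •
        (if h : k < m then Pi.single (⟨k, h⟩ : Fin m) z else 0 : Fin m → V) = ev u z := by
      intro z
      rw [hev, Finset.sum_range]
      exact Finset.sum_congr rfl fun k _ => by rw [dif_pos k.2]
    have h2 : ev u (ms x y + u • mc x y) = ev u (ms x y) + u • ev u (mc x y) := by
      funext k
      simp [ev, smul_comm u]
    rw [h2, ← h1, ← h1]
    simp only [hP, smul_add, Finset.sum_add_distrib]
    congr 1
    · rw [Finset.sum_range_succ, dif_neg (lt_irrefl m), smul_zero, add_zero]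
    · rw [Finset.sum_range_succ', dif_neg (by omega), smul_zero, add_zero, Finset.smul_sum]
      refine Finset.sum_congr rfl fun k hk => ?_
      have hk' := Finset.mem_range.1 hk
      rw [dif_pos (by omega), dif_pos hk', smul_smul, pow_succ']
      rfl
  have hmul : ∀ (u : ℂ) (j : Fin m) (x y : V), mult (ev u x) (ev (b j) y)
      = (q /ₘ (Polynomial.X - Polynomial.C (b j))).eval u • ev (b j) (ms x y + b j • mc x y) := by
    intro u j x y
    obtain ⟨Q, hQ0, hQ⟩ := exists_quotient_by_sub m
      (fun A B => q.coeff A • P x y B - q.coeff B • P x y A)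
      (by
        intro n
        rw [Finset.sum_sub_distrib, sub_eq_zero,
          ← Finset.sum_range_reflect (fun i => q.coeff i • P x y (n - i))]
        refine Finset.sum_congr rfl fun i hi => ?_
        have := Finset.mem_range.1 hi
        rw [show n + 1 - 1 - i = n - i by omega, show n - (n - i) = i by omega])
      (by
        have hc : ∀ k, m < k → q.coeff k = 0 := fun k hk =>
          Polynomial.coeff_eq_zero_of_natDegree_lt (by omega)
        rintro A B (h | h) <;> simp [hc _ h, hP0 x y _ h])
    have hm1 := hmult x y Q hQ0 hQ
    have hqb : ∑ k ∈ Finset.range (m + 1), b j ^ k * q.coeff k = 0 := by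
      have := hroot j
      rw [Polynomial.IsRoot, Polynomial.eval_eq_sum_range, hqdeg] at this
      simpa only [mul_comm] using this
    set g := q /ₘ (Polynomial.X - Polynomial.C (b j)) with hg
    set T : ℕ → (Fin m → V) := fun A => ∑ B ∈ Finset.range m, b j ^ B • Q A B with hTdef
    have hT : ∀ A, T A = g.coeff A • ev (b j) (ms x y + b j • mc x y) := by
      refine eq_coeff_divByMonic_smul (hroot j) m hqdeg.le _ T
        (fun A hA => Finset.sum_eq_zero fun B _ => by rw [hQ0 A B (Or.inl hA), smul_zero]) ?_
      intro A
      have h1 : ∑ B ∈ Finset.range (m + 1), b j ^ B •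
          (q.coeff (A + 1) • P x y B - q.coeff B • P x y (A + 1))
          = q.coeff (A + 1) • ev (b j) (ms x y + b j • mc x y) := by
        simp only [smul_sub, Finset.sum_sub_distrib]
        simp only [smul_comm _ (q.coeff (A + 1)), ← Finset.smul_sum, hPev]
        simp only [smul_smul, ← Finset.sum_smul, hqb, zero_smul, sub_zero]
      rw [← h1]
      simp only [hQ, smul_sub, Finset.sum_sub_distrib, Nat.add_one_ne_zero, if_false,
        Nat.add_sub_cancel]
      congr 1
      · rw [Finset.sum_range_succ, hQ0 A m (Or.inr le_rfl), smul_zero, add_zero]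
      · rw [Finset.sum_range_succ']
        simp [hTdef, Finset.smul_sum, smul_smul, pow_succ']
    have hgdeg : g.natDegree < m := by
      rw [hg, Polynomial.natDegree_divByMonic _ (Polynomial.monic_X_sub_C _),
        Polynomial.natDegree_X_sub_C]
      omega
    rw [hev u x, hev (b j) y]
    simp only [map_sum, map_smul, LinearMap.sum_apply, LinearMap.smul_apply, hm1]
    rw [Polynomial.eval_eq_sum_range' hgdeg, Finset.sum_smul, Finset.sum_range]
    refine Eq.trans ?_ (Finset.sum_congr rfl fun A _ =>
      show u ^ (A : ℕ) • T A = _ by rw [hT, smul_smul, mul_comm])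
    simp only [hTdef, Finset.sum_range, Finset.smul_sum]
    rw [Finset.sum_comm]
    exact Finset.sum_congr rfl fun _ _ => Finset.sum_congr rfl fun _ _ => smul_comm _ _ _
  have hg0 : ∀ i j, i ≠ j →
      (q /ₘ (Polynomial.X - Polynomial.C (b j))).eval (b i) = 0 := by
    intro i j hij
    have h := congrArg (Polynomial.eval (b i))
      (Polynomial.mul_divByMonic_eq_iff_isRoot.2 (hroot j))
    rw [Polynomial.eval_mul, (hroot i : q.eval (b i) = 0)] at h
    refine (mul_eq_zero.1 h).resolve_left ?_
    simpa [sub_eq_zero] using hbinj.ne hij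
  let d : Fin m → ℂ := fun j => (q /ₘ (Polynomial.X - Polynomial.C (b j))).eval (b j)
  have hd : ∀ j, d j ≠ 0 := by
    intro j hj
    have hqj := Polynomial.mul_divByMonic_eq_iff_isRoot.2 (hroot j)
    have hne : q /ₘ (Polynomial.X - Polynomial.C (b j)) ≠ 0 := by
      intro h
      rw [h, mul_zero] at hqj
      exact hq hqj.symm
    have hz : ∀ i, (q /ₘ (Polynomial.X - Polynomial.C (b j))).eval (b i) = 0 := fun i => by
      rcases eq_or_ne i j with rfl | hij
      · exact hj
      · exact hg0 i j hij
    refine hne (Polynomial.eq_zero_of_natDegree_lt_card_of_eval_eq_zero _ hbinj hz ?_)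
    rw [Polynomial.natDegree_divByMonic _ (Polynomial.monic_X_sub_C _),
      Polynomial.natDegree_X_sub_C, Fintype.card_fin]
    omega
  obtain ⟨f, hf⟩ := Matrix.exists_linearEquiv_sum_smul (V := V)
    ((Matrix.vandermonde b).transpose * Matrix.diagonal fun i => (d i)⁻¹) (by
      rw [Matrix.det_mul, Matrix.det_transpose, Matrix.det_diagonal]
      exact mul_ne_zero (Matrix.det_vandermonde_ne_zero_iff.2 hbinj)
        (Finset.prod_ne_zero_iff.2 fun i _ => inv_ne_zero (hd i)))
  have hfev : ∀ Z, f Z = ∑ i, (d i)⁻¹ • ev (b i) (Z i) := by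
    intro Z
    funext k
    rw [hf, Finset.sum_apply]
    refine Finset.sum_congr rfl fun i _ => ?_
    simp [ev, Matrix.mul_diagonal, Matrix.vandermonde, smul_smul, mul_comm]
  have hfmul : ∀ Z Z', mult (f Z) (f Z')
      = f fun i => ms (Z i) (Z' i) + b i • mc (Z i) (Z' i) := by
    intro Z Z'
    rw [hfev Z, hfev Z', hfev]
    simp only [map_sum, map_smul, LinearMap.sum_apply, LinearMap.smul_apply, hmul]
    refine Finset.sum_congr rfl fun j _ => ?_
    rw [Finset.smul_sum, Finset.sum_eq_single j]
    · change (d j)⁻¹ • (d j)⁻¹ • d j • _ = _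
      rw [inv_smul_smul₀ (hd j)]
    · intro i _ hij
      simp [hg0 i j hij]
    · simp
  refine ⟨f.symm, fun X Y i => ?_⟩
  have h := hfmul (f.symm X) (f.symm Y)
  rw [f.apply_symm_apply, f.apply_symm_apply] at h
  rw [h, f.symm_apply_apply]
end

section
/- Let n, p ≥ 1 and let a₁,…,a_p, b¹,…,b^p, c ∈ Mat_n(ℂ) be such that the families {1, a₁,…,a_p} and {1, b¹,…,b^p} are each linearly independent (1 the identity matrix). Suppose the bilinear multiplication x∘y = Σ_{i=1}^p (a_i x bⁱ y + x a_i y bⁱ − a_i x y bⁱ) + x c y on Mat_n(ℂ) is associative. Then there exist complex numbers φ^k_{i,j}, μ_{i,j}, ψ^{i,j}_k, λ^{i,j}, t^i_j (1 ≤ i,j,k ≤ p) such that the M-relations hold, and moreover these numbers satisfy (summation over repeated indices from 1 to p, δ the Kronecker delta): φ^s_{j,k}φ^i_{s,l} + μ_{j,k}δ^i_l = φ^i_{j,s}φ^s_{k,l} + δ^i_jμ_{k,l}; φ^s_{j,k}μ_{i,s} = φ^s_{i,j}μ_{s,k}; ψ^{i,j}_sψ^{s,k}_l + δ^k_lλ^{i,j}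 = ψ^{j,k}_sψ^{i,s}_l + δ^i_lλ^{j,k}; ψ^{i,j}_sλ^{s,k} = ψ^{j,k}_sλ^{i,s}; φ^s_{j,k}ψ^{l,i}_s = φ^l_{s,k}ψ^{s,i}_j + φ^i_{j,s}ψ^{l,s}_k + δ^l_k t^i_j − δ^i_j t^l_k − δ^i_j φ^l_{s,r}ψ^{r,s}_k; φ^s_{j,k}t^i_s = ψ^{s,i}_jμ_{s,k} + φ^i_{j,s}t^s_k − δ^i_jψ^{s,r}_kμ_{r,s}; ψ^{k,i}_s t^s_j = φ^i_{j,s}λ^{k,s} + ψ^{s,i}_j t^k_s − δ^i_jφ^k_{s,r}λ^{r,s}. -/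
/-- The M-relations for matrices `a₁,…,a_p, b¹,…,b^p, c ∈ Mat_n(ℂ)` and tensors
`φ^k_{i,j} = φ k i j`, `μ_{i,j} = μ i j`, `ψ^{i,j}_k = ψ i j k`, `λ^{i,j} = Λ i j`,
`t^i_j = t i j`. -/
def MRel (n p : ℕ) (a b : Fin p → Matrix (Fin n) (Fin n) ℂ)
    (c : Matrix (Fin n) (Fin n) ℂ)
    (φ : Fin p → Fin p → Fin p → ℂ) (μ : Fin p → Fin p → ℂ)
    (ψ : Fin p → Fin p → Fin p → ℂ) (Λ : Fin p → Fin p → ℂ)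
    (t : Fin p → Fin p → ℂ) : Prop :=
  (∀ i j, a i * a j = ∑ k, φ k i j • a k + μ i j • 1) ∧
  (∀ i j, b i * b j = ∑ k, ψ i j k • b k + Λ i j • 1) ∧
  (∀ i j, b i * a j = ∑ k, ψ k i j • a k + ∑ k, φ i j k • b k + t i j • 1
      + if i = j then c else 0) ∧
  (∀ i, b i * c = ∑ k, Λ k i • a k - ∑ k, t i k • b k
      - ∑ s, (∑ k, ∑ l, φ i k l * ψ l k s) • b s - (∑ k, ∑ l, φ i k l * Λ l k) • 1) ∧
  (∀ j, c * a j = ∑ k, μ j k • b k - ∑ k, t k j • a k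
      - ∑ s, (∑ k, ∑ l, φ s k l * ψ l k j) • a s - (∑ k, ∑ l, μ k l * ψ l k j) • 1)


section
variable {n p : ℕ}

/-- Contraction of the left factor of `x ↦ A * x * M` with a linear functional `f`. -/
def leftEval (f : Matrix (Fin n) (Fin n) ℂ →ₗ[ℂ] ℂ) :
    (Matrix (Fin n) (Fin n) ℂ → Matrix (Fin n) (Fin n) ℂ) →ₗ[ℂ] Matrix (Fin n) (Fin n) ℂ where
  toFun G := Matrix.of fun k l => ∑ i, ∑ j, f (Matrix.single i j 1) * G (Matrix.single j k 1) i l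
  map_add' G H := by
    ext k l
    simp [mul_add, Finset.sum_add_distrib]
  map_smul' r G := by
    ext k l
    simp [Finset.mul_sum, mul_left_comm]

/-- Contraction of the right factor of `z ↦ M * z * D` with a linear functional `g`. -/
def rightEval (g : Matrix (Fin n) (Fin n) ℂ →ₗ[ℂ] ℂ) :
    (Matrix (Fin n) (Fin n) ℂ → Matrix (Fin n) (Fin n) ℂ) →ₗ[ℂ] Matrix (Fin n) (Fin n) ℂ where
  toFun G := Matrix.of fun l k => ∑ i, ∑ j, g (Matrix.single i j 1) * G (Matrix.single k i 1) l j
  map_add' G H := by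
    ext k l
    simp [mul_add, Finset.sum_add_distrib]
  map_smul' r G := by
    ext k l
    simp [Finset.mul_sum, mul_left_comm]

theorem map_eq_sum_single (f : Matrix (Fin n) (Fin n) ℂ →ₗ[ℂ] ℂ) (A : Matrix (Fin n) (Fin n) ℂ) :
    f A = ∑ i, ∑ j, f (Matrix.single i j 1) * A i j := by
  conv_lhs => rw [Matrix.matrix_eq_sum_single A]
  simp only [map_sum]
  refine Finset.sum_congr rfl fun i _ => Finset.sum_congr rfl fun j _ => ?_
  rw [show Matrix.single i j (A i j) = A i j • Matrix.single i j (1 : ℂ) by simp, map_smul,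
    smul_eq_mul, mul_comm]

theorem mul_single_mul_apply (A M : Matrix (Fin n) (Fin n) ℂ) (i j k l : Fin n) :
    (A * (Matrix.single j k 1 * M) : Matrix (Fin n) (Fin n) ℂ) i l = A i j * M k l := by
  rw [Matrix.mul_apply, Finset.sum_eq_single j]
  · simp
  · intro b _ hb
    simp [hb]
  · simp

theorem leftEval_mul (f : Matrix (Fin n) (Fin n) ℂ →ₗ[ℂ] ℂ) (A M : Matrix (Fin n) (Fin n) ℂ) :
    leftEval f (fun x => A * (x * M)) = f A • M := by
  ext k l
  simp only [leftEval, LinearMap.coe_mk, AddHom.coe_mk, Matrix.of_apply, mul_single_mul_apply,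
    Matrix.smul_apply, smul_eq_mul, map_eq_sum_single f A, Finset.sum_mul, mul_assoc]

theorem rightEval_mul (g : Matrix (Fin n) (Fin n) ℂ →ₗ[ℂ] ℂ) (D M : Matrix (Fin n) (Fin n) ℂ) :
    rightEval g (fun z => M * (z * D)) = g D • M := by
  ext l k
  simp only [rightEval, LinearMap.coe_mk, AddHom.coe_mk, Matrix.of_apply, mul_single_mul_apply,
    Matrix.smul_apply, smul_eq_mul, map_eq_sum_single g D, Finset.sum_mul]
  refine Finset.sum_congr rfl fun i _ => Finset.sum_congr rfl fun j _ => ?_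
  ring

theorem leftEval_add (f : Matrix (Fin n) (Fin n) ℂ →ₗ[ℂ] ℂ)
    (G H : Matrix (Fin n) (Fin n) ℂ → Matrix (Fin n) (Fin n) ℂ) :
    leftEval f (fun x => G x + H x) = leftEval f G + leftEval f H :=
  map_add (leftEval f) G H

theorem leftEval_sub (f : Matrix (Fin n) (Fin n) ℂ →ₗ[ℂ] ℂ)
    (G H : Matrix (Fin n) (Fin n) ℂ → Matrix (Fin n) (Fin n) ℂ) :
    leftEval f (fun x => G x - H x) = leftEval f G - leftEval f H :=
  map_sub (leftEval f) G H

theorem leftEval_sum (f : Matrix (Fin n) (Fin n) ℂ →ₗ[ℂ] ℂ)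
    (G : Fin p → Matrix (Fin n) (Fin n) ℂ → Matrix (Fin n) (Fin n) ℂ) :
    leftEval f (fun x => ∑ i, G i x) = ∑ i, leftEval f (G i) := by
  rw [← map_sum]
  congr 1
  ext x : 1
  simp

theorem rightEval_add (f : Matrix (Fin n) (Fin n) ℂ →ₗ[ℂ] ℂ)
    (G H : Matrix (Fin n) (Fin n) ℂ → Matrix (Fin n) (Fin n) ℂ) :
    rightEval f (fun x => G x + H x) = rightEval f G + rightEval f H :=
  map_add (rightEval f) G H

theorem rightEval_sub (f : Matrix (Fin n) (Fin n) ℂ →ₗ[ℂ] ℂ)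
    (G H : Matrix (Fin n) (Fin n) ℂ → Matrix (Fin n) (Fin n) ℂ) :
    rightEval f (fun x => G x - H x) = rightEval f G - rightEval f H :=
  map_sub (rightEval f) G H

theorem rightEval_smul (f : Matrix (Fin n) (Fin n) ℂ →ₗ[ℂ] ℂ) (r : ℂ)
    (G : Matrix (Fin n) (Fin n) ℂ → Matrix (Fin n) (Fin n) ℂ) :
    rightEval f (fun x => r • G x) = r • rightEval f G :=
  map_smul (rightEval f) r G

theorem rightEval_sum (f : Matrix (Fin n) (Fin n) ℂ →ₗ[ℂ] ℂ)
    (G : Fin p → Matrix (Fin n) (Fin n) ℂ → Matrix (Fin n) (Fin n) ℂ) :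
    rightEval f (fun x => ∑ i, G i x) = ∑ i, rightEval f (G i) := by
  rw [← map_sum]
  congr 1
  ext x : 1
  simp

theorem leftEval_one_mul (f : Matrix (Fin n) (Fin n) ℂ →ₗ[ℂ] ℂ) (M : Matrix (Fin n) (Fin n) ℂ) :
    leftEval f (fun x => x * M) = f 1 • M := by
  simpa using leftEval_mul f 1 M

theorem leftEval_mul_mul (f : Matrix (Fin n) (Fin n) ℂ →ₗ[ℂ] ℂ) (A B M : Matrix (Fin n) (Fin n) ℂ) :
    leftEval f (fun x => A * (B * (x * M))) = f (A * B) • M := by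
  simpa only [mul_assoc] using leftEval_mul f (A * B) M

theorem rightEval_mul_one (g : Matrix (Fin n) (Fin n) ℂ →ₗ[ℂ] ℂ) (M : Matrix (Fin n) (Fin n) ℂ) :
    rightEval g (fun z => M * z) = g 1 • M := by
  simpa using rightEval_mul g 1 M

theorem rightEval_mul' (g : Matrix (Fin n) (Fin n) ℂ →ₗ[ℂ] ℂ) (M D : Matrix (Fin n) (Fin n) ℂ) :
    rightEval g (fun z => M * z * D) = g D • M := by
  simpa only [mul_assoc] using rightEval_mul g D M

theorem rightEval_mul_mul (g : Matrix (Fin n) (Fin n) ℂ →ₗ[ℂ] ℂ)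
    (M D E : Matrix (Fin n) (Fin n) ℂ) :
    rightEval g (fun z => M * z * D * E) = g (D * E) • M := by
  simpa only [mul_assoc] using rightEval_mul g (D * E) M

theorem exists_smul_one_of_commute (X : Matrix (Fin n) (Fin n) ℂ) (h : ∀ y, X * y = y * X) : ∃ r :
    ℂ, X = r • 1 := by
  have h1 := Matrix.mem_range_scalar_of_commute_single (M := X)
    (fun i j _ => (h (Matrix.single i j 1)).symm)
  obtain ⟨r, hr⟩ := h1
  exact ⟨r, by rw [← hr, Matrix.scalar_apply, Matrix.smul_one_eq_diagonal]⟩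

theorem exists_dual_of_linearIndependent {v : Fin (p + 1) → Matrix (Fin n) (Fin n) ℂ}
    (hv : LinearIndependent ℂ v)
    (k : Fin (p + 1)) : ∃ f : Matrix (Fin n) (Fin n) ℂ →ₗ[ℂ] ℂ, ∀ i, f
    (v i) = if i = k then 1 else 0 := by
  obtain ⟨g, hg⟩ := LinearMap.exists_leftInverse_of_injective (Fintype.linearCombination ℂ v)
    (LinearMap.ker_eq_bot.2 hv.fintypeLinearCombination_injective)
  refine ⟨LinearMap.proj k ∘ₗ g, fun i => ?_⟩
  have := LinearMap.congr_fun hg (Pi.single i 1)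
  simp only [LinearMap.comp_apply, Fintype.linearCombination_apply_single, one_smul,
    LinearMap.id_apply] at this
  simp [this, Pi.single_apply, eq_comm]

theorem exists_commutator_eq_smul_one (a b : Fin p → Matrix (Fin n) (Fin n) ℂ)
    (c : Matrix (Fin n) (Fin n) ℂ)
    (mc : Matrix (Fin n) (Fin n) ℂ → Matrix (Fin n) (Fin n) ℂ → Matrix (Fin n) (Fin n) ℂ)
    (hmc : ∀ x y, mc x y
      = ∑ i, (a i * x * b i * y + x * a i * y * b i - a i * x * y * b i) + x * c * y)
    (hassoc : ∀ x y z, mc (mc x y) z = mc x (mc y z))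
    (f g : Matrix (Fin n) (Fin n) ℂ →ₗ[ℂ] ℂ) (hf : f 1 = 0) (hg : g 1 = 0) :
    ∃ r : ℂ, ∑ i, ∑ j, (f (a i) * g (b j)) • (b i * a j)
      - ∑ i, ∑ j, (f (a i * a j) * g (b i)) • b j
      - ∑ i, ∑ j, (f (a i) * g (b j * b i)) • a j - (∑ i, f (a i) * g (b i)) • c = r • 1 := by
  apply exists_smul_one_of_commute
  intro y
  have h : rightEval g (fun z => leftEval f fun x => mc (mc x y) z)
      = rightEval g (fun z => leftEval f fun x => mc x (mc y z)) := by
    simp only [hassoc]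
  simp only [hmc, mul_add, add_mul, mul_sub, sub_mul, Finset.mul_sum, Finset.sum_mul, mul_assoc,
    leftEval_add, leftEval_sub, leftEval_sum, leftEval_mul, leftEval_one_mul, leftEval_mul_mul,
    hf, zero_smul] at h
  simp only [← mul_assoc,
    rightEval_add, rightEval_sub, rightEval_sum, rightEval_smul, rightEval_mul', rightEval_mul_one,
    rightEval_mul_mul, hg, zero_smul, smul_zero, Finset.sum_const_zero, add_zero, zero_add,
    sub_zero, smul_smul] at h
  simp only [Finset.sum_add_distrib, Finset.sum_sub_distrib] at h
  rw [Finset.sum_comm (f := fun i j => (f (a j) * g (b i)) • (b j * y * a i)),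
    Finset.sum_comm (f := fun i j => (f (a j) * g (b i)) • (y * b j * a i))] at h
  simp only [mul_sub, sub_mul, Finset.mul_sum, Finset.sum_mul, Finset.sum_smul,
    Matrix.smul_mul, Matrix.mul_smul, ← mul_assoc]
  rw [← sub_eq_zero] at h ⊢
  rw [← h]
  abel

theorem coeff_unique {v : Fin p → Matrix (Fin n) (Fin n) ℂ}
    (hv : LinearIndependent ℂ (Fin.cons 1 v : Fin (p + 1) → Matrix (Fin n) (Fin n) ℂ))
    {x y : Fin p → ℂ} {r s : ℂ}
    (h : ∑ k, x k • v k + r • (1 : Matrix (Fin n) (Fin n) ℂ) = ∑ k, y k • v k + s • 1) :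
    (∀ k, x k = y k) ∧ r = s := by
  have h1 := Fintype.linearIndependent_iff.1 hv (Fin.cons (r - s) (fun k => x k - y k)) (by
    simp only [Fin.sum_univ_succ, Fin.cons_zero, Fin.cons_succ, sub_smul, Finset.sum_sub_distrib]
    rw [← sub_eq_zero] at h
    rw [← h]
    abel)
  exact ⟨fun k => sub_eq_zero.1 (h1 k.succ), sub_eq_zero.1 (h1 0)⟩

theorem exists_dual_cons {v : Fin p → Matrix (Fin n) (Fin n) ℂ}
    (hv : LinearIndependent ℂ (Fin.cons 1 v : Fin (p + 1) → Matrix (Fin n) (Fin n) ℂ))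
    (k : Fin p) : ∃ f : Matrix (Fin n) (Fin n) ℂ →ₗ[ℂ] ℂ,
      f 1 = 0 ∧ ∀ i, f (v i) = if i = k then 1 else 0 := by
  obtain ⟨f, hf⟩ := exists_dual_of_linearIndependent hv k.succ
  refine ⟨f, ?_, fun i => ?_⟩
  · simpa [(Fin.succ_ne_zero k).symm] using hf 0
  · simpa using hf i.succ

theorem exists_coeff_of_dual {v : Fin p → Matrix (Fin n) (Fin n) ℂ} (A : Matrix (Fin n) (Fin n) ℂ)
    (h : ∀ f : Matrix (Fin n) (Fin n) ℂ →ₗ[ℂ] ℂ, f 1 = 0 → (∀ i, f (v i) = 0) → f A = 0) :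
    ∃ (x : Fin p → ℂ) (r : ℂ), A = ∑ k, x k • v k + r • 1 := by
  have hA : A ∈ Submodule.span ℂ
      (Set.range (Fin.cons 1 v : Fin (p + 1) → Matrix (Fin n) (Fin n) ℂ)) := by
    by_contra hA
    obtain ⟨f, hf, hle⟩ := Submodule.exists_le_ker_of_notMem hA
    have hf' : ∀ i, f ((Fin.cons 1 v : Fin (p + 1) → Matrix (Fin n) (Fin n) ℂ) i) = 0 :=
      fun i => hle (Submodule.subset_span ⟨i, rfl⟩)
    exact hf (h f (hf' 0) fun i => hf' i.succ)
  obtain ⟨x, hx⟩ := (Submodule.mem_span_range_iff_exists_fun ℂ).1 hA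
  refine ⟨fun k => x k.succ, x 0, ?_⟩
  rw [← hx, Fin.sum_univ_succ, add_comm]
  simp

theorem commute_unit_of_assoc {a b : Fin p → Matrix (Fin n) (Fin n) ℂ}
    {c : Matrix (Fin n) (Fin n) ℂ}
    (ha : LinearIndependent ℂ (Fin.cons 1 a : Fin (p + 1) → Matrix (Fin n) (Fin n) ℂ))
    (hb : LinearIndependent ℂ (Fin.cons 1 b : Fin (p + 1) → Matrix (Fin n) (Fin n) ℂ))
    {mc : Matrix (Fin n) (Fin n) ℂ → Matrix (Fin n) (Fin n) ℂ → Matrix (Fin n) (Fin n) ℂ}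
    (hmc : ∀ x y, mc x y
      = ∑ i, (a i * x * b i * y + x * a i * y * b i - a i * x * y * b i) + x * c * y)
    (hassoc : ∀ x y z, mc (mc x y) z = mc x (mc y z)) :
    (∀ k, (∑ i, a i * b i + c) * b k = b k * (∑ i, a i * b i + c)) ∧
      ∀ k, (∑ i, a i * b i + c) * a k = a k * (∑ i, a i * b i + c) := by
  have h1 : ∀ x, mc x 1 = x * (∑ i, a i * b i + c) := fun x => by
    simp [hmc, mul_add, Finset.mul_sum, mul_assoc]
  have h2 : ∀ x, mc 1 x = (∑ i, a i * b i + c) * x := fun x => by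
    simp [hmc, add_mul, Finset.sum_mul, mul_assoc]
  generalize ∑ i, a i * b i + c = u at h1 h2
  constructor
  · intro k
    obtain ⟨f, hf, hfa⟩ := exists_dual_cons ha k
    have h : leftEval f (fun x => mc (mc x 1) 1) = leftEval f (fun x => mc x (mc 1 1)) := by
      simp only [hassoc]
    simp only [h1, one_mul] at h
    simp only [hmc, mul_assoc, leftEval_add, leftEval_sub, leftEval_sum, leftEval_mul,
      leftEval_one_mul, hf, hfa, zero_smul, ite_smul, one_smul, Finset.sum_add_distrib,
      Finset.sum_sub_distrib, Finset.sum_ite_eq', Finset.mem_univ, if_true, add_zero,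
      Finset.sum_const_zero] at h
    exact (sub_eq_zero.1 h.symm).symm
  · intro k
    obtain ⟨g, hg, hgb⟩ := exists_dual_cons hb k
    have h : rightEval g (fun z => mc (mc 1 1) z) = rightEval g (fun z => mc 1 (mc 1 z)) := by
      simp only [hassoc]
    simp only [h2, mul_one] at h
    simp only [hmc, ← mul_assoc, rightEval_add, rightEval_sub, rightEval_sum, rightEval_mul',
      rightEval_mul_one, hg, hgb, zero_smul, ite_smul, one_smul, Finset.sum_add_distrib,
      Finset.sum_sub_distrib, Finset.sum_ite_eq', Finset.mem_univ, if_true, add_zero, zero_add,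
      Finset.sum_const_zero] at h
    exact sub_eq_zero.1 h

theorem sum_comm_three {M : Type*} [AddCommMonoid M] (F : Fin p → Fin p → Fin p → M) :
    ∑ i, ∑ j, ∑ k, F i j k = ∑ k, ∑ i, ∑ j, F i j k := by
  simp_rw [Finset.sum_comm (f := fun j k => F _ j k)]
  rw [Finset.sum_comm]

theorem exists_mRel_of_assoc {a b : Fin p → Matrix (Fin n) (Fin n) ℂ}
    {c : Matrix (Fin n) (Fin n) ℂ}
    (ha : LinearIndependent ℂ (Fin.cons 1 a : Fin (p + 1) → Matrix (Fin n) (Fin n) ℂ))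
    (hb : LinearIndependent ℂ (Fin.cons 1 b : Fin (p + 1) → Matrix (Fin n) (Fin n) ℂ))
    {mc : Matrix (Fin n) (Fin n) ℂ → Matrix (Fin n) (Fin n) ℂ → Matrix (Fin n) (Fin n) ℂ}
    (hmc : ∀ x y, mc x y
      = ∑ i, (a i * x * b i * y + x * a i * y * b i - a i * x * y * b i) + x * c * y)
    (hassoc : ∀ x y z, mc (mc x y) z = mc x (mc y z)) :
    ∃ φ μ ψ Λ t, MRel n p a b c φ μ ψ Λ t := by
  have H := exists_commutator_eq_smul_one a b c mc hmc hassoc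
  have hA : ∀ i j, ∃ (x : Fin p → ℂ) (r : ℂ), a i * a j = ∑ k, x k • a k + r • 1 := by
    intro i j
    refine exists_coeff_of_dual _ fun f hf hfa => ?_
    obtain ⟨g, hg, hgb⟩ := exists_dual_cons hb i
    obtain ⟨r, hr⟩ := H f g hf hg
    have h := coeff_unique (x := fun j => - f (a i * a j)) (y := 0) (r := 0) (s := r) hb (by
      simpa [hfa, hgb, ite_smul, Finset.sum_ite_irrel] using hr)
    simpa using h.1 j
  have hB : ∀ i j, ∃ (x : Fin p → ℂ) (r : ℂ), b i * b j = ∑ k, x k • b k + r • 1 := by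
    intro i j
    refine exists_coeff_of_dual _ fun g hg hgb => ?_
    obtain ⟨f, hf, hfa⟩ := exists_dual_cons ha j
    obtain ⟨r, hr⟩ := H f g hf hg
    have h := coeff_unique (x := fun i => - g (b i * b j)) (y := 0) (r := 0) (s := r) ha (by
      simpa [hfa, hgb, ite_smul, Finset.sum_ite_irrel] using hr)
    simpa using h.1 i
  choose ξ μ hφ using hA
  choose ψ Λ hψ using hB
  have hT : ∀ i j, ∃ r : ℂ, b i * a j = ∑ k, ψ k i j • a k + ∑ k, ξ j k i • b k + r • 1
      + if i = j then c else 0 := by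
    intro k l
    obtain ⟨f, hf, hfa⟩ := exists_dual_cons ha k
    obtain ⟨g, hg, hgb⟩ := exists_dual_cons hb l
    obtain ⟨r, hr⟩ := H f g hf hg
    refine ⟨r, ?_⟩
    simp [hfa, hgb, hf, hg, hφ, hψ, ite_smul, Finset.sum_ite_irrel] at hr
    rw [← hr]
    simp only [eq_comm (a := l)]
    abel
  choose t ht using hT
  obtain ⟨hub, hua⟩ := commute_unit_of_assoc ha hb hmc hassoc
  refine ⟨fun k i j => ξ i j k, μ, ψ, Λ, t, hφ, hψ, ht, fun i => ?_, fun j => ?_⟩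
  · have h := hub i
    have e : b i * c = (∑ j, a j * b j + c) * b i - ∑ j, b i * a j * b j := by
      rw [h, mul_add, Finset.mul_sum]
      simp only [mul_assoc]
      abel
    rw [e]
    simp only [add_mul, Finset.sum_mul, mul_assoc, hψ, ht, Finset.sum_add_distrib, Matrix.smul_mul,
      Finset.mul_sum, mul_add, Matrix.mul_smul, ite_mul, zero_mul, one_mul, mul_one,
      Finset.smul_sum, smul_add, smul_smul, Finset.sum_smul, Finset.sum_ite_eq, Finset.mem_univ,
      if_true]
    rw [sum_comm_three (F := fun j k s => (ξ j k i * ψ k j s) • b s),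
      Finset.sum_comm (f := fun j k => ψ k i j • (a k * b j))]
    abel
  · have h := hua j
    have e : c * a j = a j * (∑ i, a i * b i + c) - ∑ i, a i * (b i * a j) := by
      rw [← h, add_mul, Finset.sum_mul]
      simp only [mul_assoc]
      abel
    rw [e]
    simp only [mul_add, Finset.mul_sum, ← mul_assoc, hφ, ht, Finset.sum_add_distrib,
      Matrix.smul_mul, Finset.sum_mul, add_mul, Matrix.mul_smul, mul_ite, mul_zero, one_mul,
      mul_one, Finset.smul_sum, smul_add, smul_smul, Finset.sum_smul, Finset.sum_ite_eq',
      Finset.mem_univ, if_true]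
    simp only [mul_comm (ψ _ _ j)]
    rw [sum_comm_three (F := fun x y z => (ξ x y z * ψ y x j) • a z),
      Finset.sum_comm (f := fun x y => ξ j y x • (a x * b y))]
    abel

theorem structureConstants_assoc {v : Fin p → Matrix (Fin n) (Fin n) ℂ}
    (hv : LinearIndependent ℂ (Fin.cons 1 v : Fin (p + 1) → Matrix (Fin n) (Fin n) ℂ))
    {C : Fin p → Fin p → Fin p → ℂ} {m : Fin p → Fin p → ℂ}
    (h : ∀ i j, v i * v j = ∑ k, C i j k • v k + m i j • 1) (j k l : Fin p) :
    (∀ i, (∑ s, C j k s * C s l i) + (if i = l then m j k else 0)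
      = (∑ s, C k l s * C j s i) + (if i = j then m k l else 0)) ∧
    ∑ s, C j k s * m s l = ∑ s, C k l s * m j s := by
  apply coeff_unique hv
  have e := mul_assoc (v j) (v k) (v l)
  simp only [h, add_mul, mul_add, Finset.sum_mul, Finset.mul_sum, Matrix.smul_mul, Matrix.mul_smul,
    one_mul, mul_one, Finset.smul_sum, smul_add, smul_smul, Finset.sum_add_distrib] at e
  simp only [add_smul, Finset.sum_smul, Finset.sum_add_distrib, ite_smul, zero_smul,
    Finset.sum_ite_eq', Finset.mem_univ, if_true]
  rw [Finset.sum_comm (f := fun i s => (C j k s * C s l i) • v i),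
    Finset.sum_comm (f := fun i s => (C k l s * C j s i) • v i)]
  rw [← sub_eq_zero] at e ⊢
  rw [← e]
  abel

theorem MRel.left_identities {a b : Fin p → Matrix (Fin n) (Fin n) ℂ}
    {c : Matrix (Fin n) (Fin n) ℂ} {φ ψ : Fin p → Fin p → Fin p → ℂ} {μ Λ t : Fin p → Fin p → ℂ}
    (h : MRel n p a b c φ μ ψ Λ t)
    (ha : LinearIndependent ℂ (Fin.cons 1 a : Fin (p + 1) → Matrix (Fin n) (Fin n) ℂ))
    (i j k : Fin p) :
    (∀ l, (∑ s, φ s j k * ψ l i s)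
      = (∑ s, φ l s k * ψ s i j) + (∑ s, φ i j s * ψ l s k)
        + (if l = k then t i j else 0) - (if i = j then t l k else 0)
        - (if i = j then ∑ s, ∑ r, φ l s r * ψ r s k else 0)) ∧
    (∑ s, φ s j k * t i s)
      = (∑ s, ψ s i j * μ s k) + (∑ s, φ i j s * t s k)
        - (if i = j then ∑ s, ∑ r, ψ s r k * μ r s else 0) := by
  obtain ⟨haa, -, hba, -, hca⟩ := h
  have hφ : ∀ l, (∑ s, φ s j k * φ i s l) + (if i = l then μ j k else 0)
      = (∑ s, φ i j s * φ s k l) + (if i = j then μ k l else 0) := fun l => by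
    simpa only [mul_comm (φ i j _)] using (structureConstants_assoc ha haa j k l).1 i
  have hb : ∑ l, ((∑ s, φ s j k * φ i s l) + (if i = l then μ j k else 0)) • b l
      = ∑ l, ((∑ s, φ i j s * φ s k l) + (if i = j then μ k l else 0)) • b l := by
    simp only [hφ]
  apply coeff_unique ha
  have e := mul_assoc (b i) (a j) (a k)
  simp only [haa, hba, hca, add_mul, mul_add, Finset.sum_mul, Finset.mul_sum, Matrix.smul_mul,
    Matrix.mul_smul, ite_mul, zero_mul, one_mul, mul_one, Finset.smul_sum, smul_add, smul_ite,
    smul_zero, smul_smul, Finset.sum_add_distrib, Finset.sum_ite_eq, Finset.sum_ite_eq',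
    Finset.mem_univ, if_true] at e
  simp only [add_smul, Finset.sum_smul, Finset.sum_add_distrib, ite_smul, zero_smul, sub_smul,
    Finset.sum_sub_distrib, Finset.sum_ite_eq, Finset.sum_ite_eq', Finset.mem_univ, if_true] at hb ⊢
  simp only [mul_comm (ψ _ _ _) (φ _ _ _), mul_comm (ψ _ _ _) (μ _ _)] at e ⊢
  rw [Finset.sum_comm (f := fun x y => (φ y x k * ψ x i j) • a y),
    Finset.sum_comm (f := fun x y => (φ i j x * ψ y x k) • a y),
    Finset.sum_comm (f := fun x y => (φ i j x * φ x k y) • b y),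
    Finset.sum_comm (f := fun x y => (φ x j k * ψ y i x) • a y),
    Finset.sum_comm (f := fun x y => (φ x j k * φ i x y) • b y)] at e
  rw [Finset.sum_comm (f := fun x y => (μ y x * ψ x y k) • (1 : Matrix (Fin n) (Fin n) ℂ))]
  by_cases hij : i = j
  · simp only [hij, if_true, Finset.sum_smul] at e hb ⊢
    linear_combination (norm := abel) -e - hb
  · simp only [hij, if_false, Finset.sum_const_zero] at e hb ⊢
    linear_combination (norm := abel) -e - hb

theorem MRel.right_identity {a b : Fin p → Matrix (Fin n) (Fin n) ℂ}
    {c : Matrix (Fin n) (Fin n) ℂ} {φ ψ : Fin p → Fin p → Fin p → ℂ} {μ Λ t : Fin p → Fin p → ℂ}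
    (h : MRel n p a b c φ μ ψ Λ t)
    (hb : LinearIndependent ℂ (Fin.cons 1 b : Fin (p + 1) → Matrix (Fin n) (Fin n) ℂ))
    (i j k : Fin p) :
    (∑ s, ψ k i s * t s j)
      = (∑ s, φ i j s * Λ k s) + (∑ s, ψ s i j * t k s)
        - (if i = j then ∑ s, ∑ r, φ k s r * Λ r s else 0) := by
  obtain ⟨-, hbb, hba, hbc, -⟩ := h
  have hψ : ∀ r, (∑ s, ψ r k s * ψ s i j) + (if j = i then Λ r k else 0)
      = (∑ s, ψ k i s * ψ r s j) + (if j = r then Λ k i else 0) := fun r =>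
    (structureConstants_assoc hb hbb r k i).1 j
  have ha : ∑ r, ((∑ s, ψ r k s * ψ s i j) + (if j = i then Λ r k else 0)) • a r
      = ∑ r, ((∑ s, ψ k i s * ψ r s j) + (if j = r then Λ k i else 0)) • a r := by
    simp only [hψ]
  refine (coeff_unique hb (x := fun l => ∑ s, ψ k i s * φ s j l)
    (y := fun l => (∑ s, ψ s i j * φ k s l) + (∑ s, φ i j s * ψ k s l)
      + (if l = k then t i j else 0) - (if i = j then t k l else 0)
      - (if i = j then ∑ s, ∑ r, φ k s r * ψ r s l else 0)) ?_).2
  have e := mul_assoc (b k) (b i) (a j)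
  simp only [hbb, hba, hbc, add_mul, mul_add, Finset.sum_mul, Finset.mul_sum, Matrix.smul_mul,
    Matrix.mul_smul, mul_ite, mul_zero, one_mul, mul_one, Finset.smul_sum, smul_add, smul_ite,
    smul_zero, smul_smul, Finset.sum_add_distrib, Finset.sum_ite_eq, Finset.sum_ite_eq',
    Finset.mem_univ, if_true] at e
  simp only [add_smul, Finset.sum_smul, Finset.sum_add_distrib, ite_smul, zero_smul, sub_smul,
    Finset.sum_sub_distrib, Finset.sum_ite_eq, Finset.sum_ite_eq', Finset.mem_univ, if_true]
    at ha ⊢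
  simp only [mul_comm (ψ _ _ _) (φ _ _ _), mul_comm (ψ _ k _) (ψ _ _ j), eq_comm (a := j)]
    at e ha ⊢
  rw [Finset.sum_comm (f := fun x y => (ψ k i x * ψ y x j) • a y),
    Finset.sum_comm (f := fun x y => (φ x j y * ψ k i x) • b y),
    Finset.sum_comm (f := fun x y => (ψ x i j * ψ y k x) • a y),
    Finset.sum_comm (f := fun x y => (φ k x y * ψ x i j) • b y),
    Finset.sum_comm (f := fun x y => (φ i j x * ψ k x y) • b y)] at e
  by_cases hij : i = j
  · simp only [hij, if_true, Finset.sum_smul] at e ha ⊢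
    linear_combination (norm := abel) e + ha
  · simp only [hij, if_false, Finset.sum_const_zero] at e ha ⊢
    linear_combination (norm := abel) e + ha

end

/-- Theorem 2.1 (direct part): if the multiplication
`x∘y = Σᵢ (aᵢxbⁱy + xaᵢybⁱ − aᵢxybⁱ) + xcy` on `Mat_n(ℂ)` is associative and
`{1,a₁,…,a_p}`, `{1,b¹,…,b^p}` are linearly independent, then there exist tensors
satisfying the M-relations together with the listed identities. -/
theorem stmt_9 (n p : ℕ) (hn : 1 ≤ n) (hp : 1 ≤ p)
    (a b : Fin p → Matrix (Fin n) (Fin n) ℂ) (c : Matrix (Fin n) (Fin n) ℂ)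
    (ha : LinearIndependent ℂ (Fin.cons 1 a : Fin (p + 1) → Matrix (Fin n) (Fin n) ℂ))
    (hb : LinearIndependent ℂ (Fin.cons 1 b : Fin (p + 1) → Matrix (Fin n) (Fin n) ℂ))
    (mc : Matrix (Fin n) (Fin n) ℂ → Matrix (Fin n) (Fin n) ℂ → Matrix (Fin n) (Fin n) ℂ)
    (hmc : ∀ x y, mc x y
      = ∑ i, (a i * x * b i * y + x * a i * y * b i - a i * x * y * b i) + x * c * y)
    (hassoc : ∀ x y z, mc (mc x y) z = mc x (mc y z)) :
    ∃ φ μ ψ Λ t, MRel n p a b c φ μ ψ Λ t ∧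
      (∀ i j k l, (∑ s, φ s j k * φ i s l) + (if i = l then μ j k else 0)
          = (∑ s, φ i j s * φ s k l) + (if i = j then μ k l else 0)) ∧
      (∀ i j k, (∑ s, φ s j k * μ i s) = ∑ s, φ s i j * μ s k) ∧
      (∀ i j k l, (∑ s, ψ i j s * ψ s k l) + (if k = l then Λ i j else 0)
          = (∑ s, ψ j k s * ψ i s l) + (if i = l then Λ j k else 0)) ∧
      (∀ i j k, (∑ s, ψ i j s * Λ s k) = ∑ s, ψ j k s * Λ i s) ∧
      (∀ i j k l, (∑ s, φ s j k * ψ l i s)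
          = (∑ s, φ l s k * ψ s i j) + (∑ s, φ i j s * ψ l s k)
            + (if l = k then t i j else 0) - (if i = j then t l k else 0)
            - (if i = j then ∑ s, ∑ r, φ l s r * ψ r s k else 0)) ∧
      (∀ i j k, (∑ s, φ s j k * t i s)
          = (∑ s, ψ s i j * μ s k) + (∑ s, φ i j s * t s k)
            - (if i = j then ∑ s, ∑ r, ψ s r k * μ r s else 0)) ∧
      (∀ i j k, (∑ s, ψ k i s * t s j)
          = (∑ s, φ i j s * Λ k s) + (∑ s, ψ s i j * t k s)
            - (if i = j then ∑ s, ∑ r, φ k s r * Λ r s else 0)) := by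
  obtain ⟨φ, μ, ψ, Λ, t, h⟩ := exists_mRel_of_assoc ha hb hmc hassoc
  have hA := structureConstants_assoc (C := fun i j k => φ k i j) ha h.1
  have hB := structureConstants_assoc hb h.2.1
  refine ⟨φ, μ, ψ, Λ, t, h, fun i j k l => ?_, fun i j k => ?_, fun i j k l => ?_,
    fun i j k => (hB i j k).2, fun i j k l => (h.left_identities ha i j k).1 l,
    fun i j k => (h.left_identities ha i j k).2, fun i j k => h.right_identity hb i j k⟩
  · simpa only [mul_comm (φ i j _)] using (hA j k l).1 i
  · exact (hA i j k).2.symm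
  · simpa only [mul_comm (ψ i _ l), eq_comm (a := l)] using (hB i j k).1 l
end

section
/- Let n, p ≥ 1 and let a₁,…,a_p, b¹,…,b^p, c ∈ Mat_n(ℂ), and suppose there exist complex numbers φ^k_{i,j}, μ_{i,j}, ψ^{i,j}_k, λ^{i,j}, t^i_j (1 ≤ i,j,k ≤ p) such that the M-relations hold. Then the bilinear multiplication x∘y = Σ_{i=1}^p (a_i x bⁱ y + x a_i y bⁱ − a_i x y bⁱ) + x c y on Mat_n(ℂ) is associative and is compatible with the usual matrix product, i.e. for every λ ∈ ℂ the multiplication x•y = xy + λ·(x∘y) is associative. -/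
/-- If an additive map `R` on a ring satisfies three quadratic identities, the product
`R x * y + x * R y - R (x * y) + x * c * y` is associative. -/
theorem assoc_of_quadratic_identities {S : Type*} [Ring S] (R : S →+ S) (A B T : S → S)
    (c f g : S)
    (h₁ : ∀ x y, R (R x * y) + R (x * R y) + R (x * c * y)
      = R x * R y + x * B y + A x * y - T (x * y))
    (h₂ : ∀ w, R (R w) + R w * c = A w - T w - w * f)
    (h₃ : ∀ v, R (R v) + c * R v + T v = B v + g * v)
    (m : S → S → S) (hm : ∀ x y, m x y = R x * y + x * R y - R (x * y) + x * c * y)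
    (x y z : S) : m (m x y) z = m x (m y z) := by
  have e₁ := h₁ x y
  have e₂ := h₁ x (y * z)
  have e₃ := h₁ (x * y) z
  have e₄ := h₁ y z
  rw [hm (m x y) z, hm x (m y z), hm x y, hm y z]
  simp only [map_add, map_sub, add_mul, mul_add, sub_mul, mul_sub, mul_assoc] at *
  have d₁ := congrArg (· * z) e₁
  have d₄ := congrArg (x * ·) e₄
  have f₁ := congrArg (· * z) (h₂ (x * y))
  have f₂ := congrArg (x * ·) (h₃ (y * z))
  have f₃ := congrArg (fun u => x * (u * z)) (h₂ y)
  have f₄ := congrArg (fun u => x * (u * z)) (h₃ y)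
  simp only [add_mul, mul_add, sub_mul, mul_sub, mul_assoc] at d₁ d₄ f₁ f₂ f₃ f₄
  rw [← sub_eq_zero] at *
  have key := congrArg₂ (· + ·) (congrArg₂ (· - ·) (congrArg₂ (· + ·) d₁ e₃)
    (congrArg₂ (· + ·) e₂ d₄)) (congrArg₂ (· + ·) (congrArg₂ (· - ·) f₂ f₁)
      (congrArg₂ (· - ·) f₃ f₄))
  simp only [add_zero, sub_zero] at key
  rw [← key]
  abel

theorem sum_rotate_one {ι M : Type*} [Fintype ι] [AddCommMonoid M] (F : ι → ι → ι → M) :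
    ∑ k, ∑ l, ∑ i, F k l i = ∑ i, ∑ k, ∑ l, F k l i :=
  (Finset.sum_congr rfl fun _ _ => Finset.sum_comm).trans Finset.sum_comm

theorem sum_rotate_two {ι M : Type*} [Fintype ι] [AddCommMonoid M] (F : ι → ι → ι → ι → M) :
    ∑ k, ∑ l, ∑ i, ∑ s, F k l i s = ∑ i, ∑ s, ∑ k, ∑ l, F k l i s :=
  (sum_rotate_one fun k l i => ∑ s, F k l i s).trans
    (Finset.sum_congr rfl fun _ _ => sum_rotate_one _)

/-- The sandwich sum `x ↦ ∑ i, a i * x * b i` as a linear map. -/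
def sandwich {n p : ℕ} (a b : Fin p → Matrix (Fin n) (Fin n) ℂ) :
    Matrix (Fin n) (Fin n) ℂ →ₗ[ℂ] Matrix (Fin n) (Fin n) ℂ where
  toFun x := ∑ i, a i * x * b i
  map_add' x y := by simp only [mul_add, add_mul, Finset.sum_add_distrib]
  map_smul' l x := by
    simp only [mul_smul_comm, smul_mul_assoc, ← Finset.smul_sum, RingHom.id_apply]

theorem sandwich_apply {n p : ℕ} (a b : Fin p → Matrix (Fin n) (Fin n) ℂ)
    (x : Matrix (Fin n) (Fin n) ℂ) : sandwich a b x = ∑ i, a i * x * b i := rfl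

section

variable {n p : ℕ} {a b : Fin p → Matrix (Fin n) (Fin n) ℂ} {c : Matrix (Fin n) (Fin n) ℂ}
  {φ : Fin p → Fin p → Fin p → ℂ} {μ : Fin p → Fin p → ℂ}
  {ψ : Fin p → Fin p → Fin p → ℂ} {Λ : Fin p → Fin p → ℂ} {t : Fin p → Fin p → ℂ}

theorem MRel.sandwich_sandwich_mul (hM : MRel n p a b c φ μ ψ Λ t)
    (x y : Matrix (Fin n) (Fin n) ℂ) :
    sandwich a b (sandwich a b x * y)
      = ∑ j, ∑ i, ∑ k, φ k j i • (a k * x * b i * y * b j)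
        + x * ∑ j, ∑ i, μ j i • (b i * y * b j) := by
  have h (i j) : a j * (a i * x * b i * y) * b j
      = ∑ k, φ k j i • (a k * x * b i * y * b j) + x * μ j i • (b i * y * b j) := by
    calc _ = (a j * a i) * x * b i * y * b j := by simp only [mul_assoc]
      _ = _ := by
        rw [hM.1 j i]
        simp only [add_mul, Finset.sum_mul, smul_mul_assoc, one_mul, mul_smul_comm, mul_assoc]
  simp only [sandwich_apply, Finset.sum_mul, Finset.mul_sum, h, Finset.sum_add_distrib]

theorem MRel.sandwich_mul_sandwich (hM : MRel n p a b c φ μ ψ Λ t)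
    (x y : Matrix (Fin n) (Fin n) ℂ) :
    sandwich a b (x * sandwich a b y)
      = ∑ j, ∑ i, ∑ k, ψ i j k • (a j * x * a i * y * b k)
        + (∑ j, ∑ i, Λ i j • (a j * x * a i)) * y := by
  have h (i j) : a j * (x * (a i * y * b i)) * b j
      = ∑ k, ψ i j k • (a j * x * a i * y * b k) + Λ i j • (a j * x * a i) * y := by
    calc _ = a j * x * a i * y * (b i * b j) := by simp only [mul_assoc]
      _ = _ := by
        rw [hM.2.1 i j]
        simp only [mul_add, Finset.mul_sum, smul_mul_assoc, mul_one, mul_smul_comm]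
  simp only [sandwich_apply, Finset.sum_mul, Finset.mul_sum, h, Finset.sum_add_distrib]

theorem MRel.mul_of_sandwich (hM : MRel n p a b c φ μ ψ Λ t)
    (x y : Matrix (Fin n) (Fin n) ℂ) :
    sandwich a b x * sandwich a b y
      = ∑ j, ∑ i, ∑ k, φ k j i • (a k * x * b i * y * b j)
        + ∑ j, ∑ i, ∑ k, ψ i j k • (a j * x * a i * y * b k)
        + ∑ i, ∑ j, t i j • (a i * (x * y) * b j) + sandwich a b (x * c * y) := by
  have h (i j) : a i * x * b i * (a j * y * b j)
      = ∑ k, ψ k i j • (a i * x * a k * y * b j) + ∑ k, φ i j k • (a i * x * b k * y * b j)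
        + t i j • (a i * (x * y) * b j) + if i = j then a i * (x * c * y) * b j else 0 := by
    calc _ = a i * x * (b i * a j) * y * b j := by simp only [mul_assoc]
      _ = _ := by
        rw [hM.2.2.1 i j]
        split_ifs <;>
        simp only [mul_add, add_mul, Finset.mul_sum, Finset.sum_mul, smul_mul_assoc, mul_one,
          mul_smul_comm, mul_assoc, mul_zero, zero_mul]
  have hφ : ∑ i, ∑ j, ∑ k, φ i j k • (a i * x * b k * y * b j)
      = ∑ j, ∑ i, ∑ k, φ k j i • (a k * x * b i * y * b j) := by
    rw [Finset.sum_comm]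
    exact Finset.sum_congr rfl fun _ _ => Finset.sum_comm
  have hψ : ∑ i, ∑ j, ∑ k, ψ k i j • (a i * x * a k * y * b j)
      = ∑ j, ∑ i, ∑ k, ψ i j k • (a j * x * a i * y * b k) :=
    Finset.sum_congr rfl fun _ _ => Finset.sum_comm
  rw [← hφ, ← hψ]
  simp only [sandwich_apply, Finset.sum_mul_sum, h, Finset.sum_add_distrib,
    Finset.sum_ite_eq, Finset.mem_univ, if_true]
  abel

theorem MRel.sandwich_sandwich (hM : MRel n p a b c φ μ ψ Λ t)
    (w : Matrix (Fin n) (Fin n) ℂ) :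
    sandwich a b (sandwich a b w)
      = ∑ i, ∑ s, (∑ k, ∑ l, φ i k l * ψ l k s) • (a i * w * b s)
        + ∑ i, (∑ k, ∑ l, φ i k l * Λ l k) • (a i * w)
        + ∑ s, (∑ k, ∑ l, μ k l * ψ l k s) • (w * b s)
        + (∑ k, ∑ l, μ k l * Λ l k) • w := by
  have h (k l) : a k * (a l * w * b l) * b k
      = ∑ i, ∑ s, (φ i k l * ψ l k s) • (a i * w * b s)
        + ∑ i, (φ i k l * Λ l k) • (a i * w)
        + ∑ s, (μ k l * ψ l k s) • (w * b s) + (μ k l * Λ l k) • w := by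
    calc _ = (a k * a l) * w * (b l * b k) := by simp only [mul_assoc]
      _ = _ := by
        rw [hM.1 k l, hM.2.1 l k]
        simp only [mul_add, add_mul, Finset.mul_sum, Finset.sum_mul, smul_mul_assoc, mul_one,
          one_mul, mul_smul_comm, smul_add, smul_smul, Finset.smul_sum, Finset.sum_add_distrib]
        simp only [mul_comm (φ _ _ _), mul_comm (μ _ _)]
        rw [Finset.sum_comm]
        abel
  simp only [Finset.sum_smul]
  rw [← sum_rotate_two, ← sum_rotate_one fun k l i => (φ i k l * Λ l k) • (a i * w),
    ← sum_rotate_one fun k l s => (μ k l * ψ l k s) • (w * b s)]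
  simp only [sandwich_apply, Finset.sum_mul, Finset.mul_sum, h, Finset.sum_add_distrib]

theorem MRel.sandwich_mul_right (hM : MRel n p a b c φ μ ψ Λ t)
    (w : Matrix (Fin n) (Fin n) ℂ) :
    sandwich a b w * c
      = ∑ j, ∑ i, Λ i j • (a j * w * a i) - ∑ i, ∑ j, t i j • (a i * w * b j)
        - ∑ i, ∑ s, (∑ k, ∑ l, φ i k l * ψ l k s) • (a i * w * b s)
        - ∑ i, (∑ k, ∑ l, φ i k l * Λ l k) • (a i * w) := by
  have h (i) : a i * w * b i * c = ∑ k, Λ k i • (a i * w * a k) - ∑ k, t i k • (a i * w * b k)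
      - ∑ s, (∑ k, ∑ l, φ i k l * ψ l k s) • (a i * w * b s)
      - (∑ k, ∑ l, φ i k l * Λ l k) • (a i * w) := by
    rw [mul_assoc, hM.2.2.2.1 i]
    simp only [mul_sub, Finset.mul_sum, mul_smul_comm, mul_one]
  simp only [sandwich_apply, Finset.sum_mul, h, Finset.sum_sub_distrib]

theorem MRel.mul_sandwich_left (hM : MRel n p a b c φ μ ψ Λ t)
    (v : Matrix (Fin n) (Fin n) ℂ) :
    c * sandwich a b v
      = ∑ j, ∑ i, μ j i • (b i * v * b j) - ∑ i, ∑ j, t i j • (a i * v * b j)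
        - ∑ i, ∑ s, (∑ k, ∑ l, φ i k l * ψ l k s) • (a i * v * b s)
        - ∑ s, (∑ k, ∑ l, μ k l * ψ l k s) • (v * b s) := by
  have h (j) : c * (a j * v * b j) = ∑ k, μ j k • (b k * v * b j) - ∑ k, t k j • (a k * v * b j)
      - ∑ i, (∑ k, ∑ l, φ i k l * ψ l k j) • (a i * v * b j)
      - (∑ k, ∑ l, μ k l * ψ l k j) • (v * b j) := by
    rw [mul_assoc, ← mul_assoc, hM.2.2.2.2 j]
    simp only [sub_mul, Finset.sum_mul, smul_mul_assoc, one_mul, mul_assoc]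
  simp only [sandwich_apply, Finset.mul_sum, h, Finset.sum_sub_distrib]
  rw [Finset.sum_comm (f := fun i j => t i j • (a i * v * b j)),
    Finset.sum_comm (f := fun i s => (∑ k, ∑ l, φ i k l * ψ l k s) • (a i * v * b s))]

end

/-- Theorem 2.1/2.2 (converse part): if the M-relations hold, then the multiplication
`x∘y = Σᵢ (aᵢxbⁱy + xaᵢybⁱ − aᵢxybⁱ) + xcy` on `Mat_n(ℂ)` is associative and
compatible with the usual matrix product. -/
theorem stmt_10 (n p : ℕ) (hn : 1 ≤ n) (hp : 1 ≤ p)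
    (a b : Fin p → Matrix (Fin n) (Fin n) ℂ) (c : Matrix (Fin n) (Fin n) ℂ)
    (φ : Fin p → Fin p → Fin p → ℂ) (μ : Fin p → Fin p → ℂ)
    (ψ : Fin p → Fin p → Fin p → ℂ) (Λ : Fin p → Fin p → ℂ)
    (t : Fin p → Fin p → ℂ)
    (hM : MRel n p a b c φ μ ψ Λ t)
    (mc : Matrix (Fin n) (Fin n) ℂ → Matrix (Fin n) (Fin n) ℂ → Matrix (Fin n) (Fin n) ℂ)
    (hmc : ∀ x y, mc x y
      = ∑ i, (a i * x * b i * y + x * a i * y * b i - a i * x * y * b i) + x * c * y) :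
    (∀ x y z, mc (mc x y) z = mc x (mc y z)) ∧
    (∀ (l : ℂ) (x y z : Matrix (Fin n) (Fin n) ℂ),
      (x * y + l • mc x y) * z + l • mc (x * y + l • mc x y) z
        = x * (y * z + l • mc y z) + l • mc x (y * z + l • mc y z)) := by
  have hm (x y) : mc x y
      = sandwich a b x * y + x * sandwich a b y - sandwich a b (x * y) + x * c * y := by
    rw [hmc]
    simp only [sandwich_apply, Finset.sum_mul, Finset.mul_sum, Finset.sum_add_distrib,
      Finset.sum_sub_distrib, mul_assoc]
  have assoc (x y z) : mc (mc x y) z = mc x (mc y z) := by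
    refine assoc_of_quadratic_identities (sandwich a b).toAddMonoidHom
      (fun x => ∑ j, ∑ i, Λ i j • (a j * x * a i)) (fun x => ∑ j, ∑ i, μ j i • (b i * x * b j))
      (fun x => ∑ i, ∑ j, t i j • (a i * x * b j)) c
      (-(∑ s, (∑ k, ∑ l, μ k l * ψ l k s) • b s + (∑ k, ∑ l, μ k l * Λ l k) • 1))
      (∑ i, (∑ k, ∑ l, φ i k l * Λ l k) • a i + (∑ k, ∑ l, μ k l * Λ l k) • 1)
      (fun x y => ?_) (fun w => ?_) (fun v => ?_) mc hm x y z
    · simp only [LinearMap.toAddMonoidHom_coe]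
      rw [hM.sandwich_sandwich_mul, hM.sandwich_mul_sandwich, hM.mul_of_sandwich]
      abel
    · simp only [LinearMap.toAddMonoidHom_coe]
      rw [hM.sandwich_sandwich, hM.sandwich_mul_right, mul_neg, mul_add, Finset.mul_sum]
      simp only [mul_smul_comm, mul_one]
      abel
    · simp only [LinearMap.toAddMonoidHom_coe]
      rw [hM.sandwich_sandwich, hM.mul_sandwich_left, add_mul, Finset.sum_mul]
      simp only [smul_mul_assoc, one_mul]
      abel
  refine ⟨assoc, fun l x y z => ?_⟩
  have first_order : mc x y * z + mc (x * y) z = x * mc y z + mc x (y * z) := by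
    simp only [hm, add_mul, mul_add, sub_mul, mul_sub, mul_assoc]
    abel
  have left : mc (x * y + l • mc x y) z = mc (x * y) z + l • mc (mc x y) z := by
    rw [hm, hm (x * y), hm (mc x y)]
    simp only [map_add, map_smul, add_mul, smul_mul_assoc, smul_add, smul_sub]
    abel
  have right : mc x (y * z + l • mc y z) = mc x (y * z) + l • mc x (mc y z) := by
    rw [hm, hm x (y * z), hm x (mc y z)]
    simp only [map_add, map_smul, mul_add, mul_smul_comm, smul_add, smul_sub]
    abel
  rw [left, right, assoc, add_mul, mul_add, smul_mul_assoc, mul_smul_comm, add_assoc, add_assoc,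
    ← smul_add, ← smul_add, ← add_assoc, ← add_assoc, first_order, mul_assoc]
end

section
/- Let n, p ≥ 1 and let a₁,…,a_p, b¹,…,b^p, c ∈ Mat_n(ℂ) with {1, a₁,…,a_p} and {1, b¹,…,b^p} each linearly independent, and suppose complex numbers φ^k_{i,j}, μ_{i,j}, ψ^{i,j}_k, λ^{i,j}, t^i_j satisfy the M-relations. Define linear operators on Mat_n(ℂ) by R(x) = Σ_i a_i x bⁱ + c x and S(x) = Σ_{i,j} μ_{j,i}(bⁱ x bʲ − Σ_k ψ^{i,j}_k x b^k − λ^{i,j} x). Then for all x, y ∈ Mat_n(ℂ): R(R(x)y + xR(y)) − R(x)R(y) − R(R(xy)) = S(x)y + xS(y) − S(xy). In particular, R satisfies R(R(x)y + xR(y)) − R(x)R(y) − R(R(xy)) = 0 for all x, y if and only if μ_{i,j} = 0 for all i, j. -/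
lemma sum_rotate {ι A : Type*} [Fintype ι] [AddCommMonoid A] (f : ι → ι → ι → A) :
    ∑ i, ∑ j, ∑ k, f i j k = ∑ k, ∑ i, ∑ j, f i j k := by
  rw [Finset.sum_congr rfl fun i _ => Finset.sum_comm, Finset.sum_comm]

section SumIdentities

variable {ι A : Type*} [Fintype ι] [Ring A] [Algebra ℂ A]

/-- Contracting a pair of structure tensors inside a double sum of products. -/
lemma sum_sum_mul_mul_eq (a b : ι → A) (φ ψ : ι → ι → ι → ℂ) (μ Λ : ι → ι → ℂ)
    (haa : ∀ i j, a i * a j = ∑ k, φ k i j • a k + μ i j • 1)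
    (hbb : ∀ i j, b i * b j = ∑ k, ψ i j k • b k + Λ i j • 1) (z : A) :
    ∑ i, ∑ j, a i * a j * z * (b j * b i)
      = ∑ k, ∑ s, (∑ i, ∑ j, φ k i j * ψ j i s) • (a k * z * b s)
        + ∑ k, (∑ i, ∑ j, φ k i j * Λ j i) • (a k * z)
        + ∑ s, (∑ i, ∑ j, μ i j * ψ j i s) • (z * b s)
        + (∑ i, ∑ j, μ i j * Λ j i) • z := by
  have e1 : ∑ k, ∑ s, (∑ i, ∑ j, φ k i j * ψ j i s) • (a k * z * b s)
      = ∑ i, ∑ j, ∑ k, ∑ s, (φ k i j * ψ j i s) • (a k * z * b s) := by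
    simp only [Finset.sum_smul]
    rw [sum_rotate fun i j k => ∑ s, (φ k i j * ψ j i s) • (a k * z * b s)]
    refine Finset.sum_congr rfl fun k _ => ?_
    exact (sum_rotate fun i j s => (φ k i j * ψ j i s) • (a k * z * b s)).symm
  have e2 : ∑ k, (∑ i, ∑ j, φ k i j * Λ j i) • (a k * z)
      = ∑ i, ∑ j, ∑ k, (φ k i j * Λ j i) • (a k * z) := by
    simp only [Finset.sum_smul]
    exact (sum_rotate _).symm
  have e3 : ∑ s, (∑ i, ∑ j, μ i j * ψ j i s) • (z * b s)
      = ∑ i, ∑ j, ∑ s, (μ i j * ψ j i s) • (z * b s) := by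
    simp only [Finset.sum_smul]
    exact (sum_rotate _).symm
  rw [e1, e2, e3]
  simp only [Finset.sum_smul, ← Finset.sum_add_distrib]
  refine Finset.sum_congr rfl fun i _ => Finset.sum_congr rfl fun j _ => ?_
  rw [haa, hbb]
  simp only [add_mul, mul_add, Finset.sum_mul, Finset.mul_sum, smul_mul_assoc, mul_smul_comm,
    mul_smul, Finset.smul_sum, smul_add, one_mul, mul_one, Finset.sum_add_distrib]
  rw [Finset.sum_comm]
  simp only [smul_comm (ψ _ _ _), smul_comm (Λ _ _)]
  abel

/-- The defect of the Rota–Baxter type identity for `x ↦ ∑ aᵢ x bⁱ + c x`, where the products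
of the coefficients satisfy the M-relations. -/
lemma operator_identity [DecidableEq ι] (a b : ι → A) (c : A) (φ ψ : ι → ι → ι → ℂ)
    (μ Λ t : ι → ι → ℂ)
    (haa : ∀ i j, a i * a j = ∑ k, φ k i j • a k + μ i j • 1)
    (hbb : ∀ i j, b i * b j = ∑ k, ψ i j k • b k + Λ i j • 1)
    (hba : ∀ i j, b i * a j = ∑ k, ψ k i j • a k + ∑ k, φ i j k • b k + t i j • 1
      + if i = j then c else 0)
    (hbc : ∀ i, b i * c = ∑ k, Λ k i • a k - ∑ k, t i k • b k
      - ∑ s, (∑ k, ∑ l, φ i k l * ψ l k s) • b s - (∑ k, ∑ l, φ i k l * Λ l k) • 1)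
    (hca : ∀ j, c * a j = ∑ k, μ j k • b k - ∑ k, t k j • a k
      - ∑ s, (∑ k, ∑ l, φ s k l * ψ l k j) • a s - (∑ k, ∑ l, μ k l * ψ l k j) • 1)
    (R S : A → A) (hR : ∀ x, R x = ∑ i, a i * x * b i + c * x)
    (hS : ∀ x, S x = ∑ i, ∑ j, μ j i •
      (b i * x * b j - ∑ k, ψ i j k • (x * b k) - Λ i j • x)) (x y : A) :
    R (R x * y + x * R y) - R x * R y - R (R (x * y)) = S x * y + x * S y - S (x * y) := by
  have expand : R (R x * y + x * R y) - R x * R y - R (R (x * y))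
      = ∑ i, ∑ j, a i * a j * (x * b j * y * b i)
        + ∑ j, c * a j * (x * b j * y)
        + ∑ i, ∑ j, a i * x * a j * y * (b j * b i)
        + ∑ i, a i * x * c * y * b i
        - ∑ i, ∑ j, a i * x * (b i * a j) * (y * b j)
        - ∑ i, a i * x * (b i * c) * y
        - ∑ i, ∑ j, a i * a j * (x * y) * (b j * b i)
        - ∑ j, c * a j * (x * y * b j) := by
    simp only [hR, add_mul, mul_add, Finset.sum_mul, Finset.mul_sum, Finset.sum_add_distrib,
      mul_assoc]
    rw [Finset.sum_comm (f := fun i j => a j * (x * (b j * (a i * (y * b i)))))]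
    abel
  set G : ι → ι → ℂ := fun s j => ∑ k, ∑ l, φ s k l * ψ l k j with hG
  set H : ι → ℂ := fun i => ∑ k, ∑ l, φ i k l * Λ l k with hH
  set N : ι → ℂ := fun j => ∑ k, ∑ l, μ k l * ψ l k j with hN
  have t1 : ∑ i, ∑ j, a i * a j * (x * b j * y * b i)
      = ∑ i, ∑ j, ∑ k, φ i j k • (a i * x * b k * y * b j)
        + ∑ i, ∑ j, μ j i • (x * b i * y * b j) := by
    rw [Finset.sum_comm (f := fun i j => μ j i • (x * b i * y * b j)),
      ← sum_rotate fun j k i => φ i j k • (a i * x * b k * y * b j)]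
    simp only [haa, add_mul, Finset.sum_mul, Finset.sum_add_distrib, smul_mul_assoc, one_mul,
      mul_assoc]
  have tca (z : ι → A) : ∑ j, c * a j * z j
      = ∑ k, ∑ j, μ j k • (b k * z j) - ∑ k, ∑ j, t k j • (a k * z j)
        - ∑ k, ∑ j, G k j • (a k * z j) - ∑ j, N j • z j := by
    rw [Finset.sum_comm (f := fun k j => μ j k • (b k * z j)),
      Finset.sum_comm (f := fun k j => t k j • (a k * z j)),
      Finset.sum_comm (f := fun k j => G k j • (a k * z j))]
    simp only [hca, sub_mul, Finset.sum_mul, Finset.sum_sub_distrib, smul_mul_assoc, one_mul,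
      hG, hN]
  have t3 : ∑ i, ∑ j, a i * x * a j * y * (b j * b i)
      = ∑ i, ∑ j, ∑ k, ψ k i j • (a i * x * a k * y * b j)
        + ∑ i, ∑ j, Λ j i • (a i * x * a j * y) := by
    simp only [hbb, mul_add, Finset.mul_sum, Finset.sum_add_distrib, mul_smul_comm, mul_one]
    congr 1
    exact Finset.sum_congr rfl fun i _ => Finset.sum_comm
  have t5 : ∑ i, ∑ j, a i * x * (b i * a j) * (y * b j)
      = ∑ i, ∑ j, ∑ k, ψ k i j • (a i * x * a k * y * b j)
        + ∑ i, ∑ j, ∑ k, φ i j k • (a i * x * b k * y * b j)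
        + ∑ i, ∑ j, t i j • (a i * (x * y * b j))
        + ∑ i, a i * x * c * y * b i := by
    simp only [hba, mul_add, add_mul, Finset.mul_sum, Finset.sum_mul, Finset.sum_add_distrib,
      mul_smul_comm, smul_mul_assoc, mul_ite, ite_mul, mul_zero, zero_mul, Finset.sum_ite_eq,
      Finset.mem_univ, if_true, mul_assoc, one_mul]
  have t6 : ∑ i, a i * x * (b i * c) * y
      = ∑ i, ∑ j, Λ j i • (a i * x * a j * y)
        - ∑ i, ∑ j, t i j • (a i * (x * b j * y))
        - ∑ i, ∑ j, G i j • (a i * (x * b j * y))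
        - ∑ i, H i • (a i * (x * y)) := by
    simp only [hbc, mul_sub, sub_mul, Finset.mul_sum, Finset.sum_mul, Finset.sum_sub_distrib,
      mul_smul_comm, smul_mul_assoc, mul_assoc, one_mul, hG, hH]
  have hS' (z : A) : S z = ∑ i, ∑ j, μ j i • (b i * z * b j) - ∑ j, N j • (z * b j)
      - (∑ i, ∑ j, μ i j * Λ j i) • z := by
    have e1 : ∑ j, N j • (z * b j) = ∑ i, ∑ j, ∑ k, (μ j i * ψ i j k) • (z * b k) := by
      simp only [hN, Finset.sum_smul]
      rw [← sum_rotate fun i j k => (μ i j * ψ j i k) • (z * b k), Finset.sum_comm]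
    have e2 : ∑ i, ∑ j, μ i j * Λ j i = ∑ i, ∑ j, μ j i * Λ i j := Finset.sum_comm
    rw [hS, e1, e2]
    simp only [smul_sub, Finset.smul_sum, smul_smul, Finset.sum_sub_distrib, Finset.sum_smul]
  rw [expand, t1, tca (fun j => x * b j * y), t3, t5, t6,
    sum_sum_mul_mul_eq a b φ ψ μ Λ haa hbb (x * y), tca (fun j => x * y * b j),
    hS', hS', hS']
  simp only [sub_mul, mul_sub, Finset.sum_mul, Finset.mul_sum, smul_mul_assoc, mul_smul_comm,
    mul_assoc]
  abel

end SumIdentities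

/-- If the `A i` are linearly independent and `∑ A i * x * C i = 0` for every matrix `x`, then all
`C i` vanish. -/
lemma coeff_eq_zero_of_sum_mul_mul_eq_zero {m ι : Type*} [Fintype m] [DecidableEq m]
    [Fintype ι] {A C : ι → Matrix m m ℂ} (hA : LinearIndependent ℂ A)
    (h : ∀ x, ∑ i, A i * x * C i = 0) (i : ι) : C i = 0 := by
  ext l s
  refine Fintype.linearIndependent_iff.mp hA (fun i => C i l s) ?_ i
  ext r k
  have := congrFun (congrFun (h (Matrix.single k l 1)) r) s
  simpa [Matrix.sum_apply, Matrix.mul_apply, Matrix.single_apply, Finset.sum_mul, mul_comm,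
    ite_and, mul_ite] using this

/-- A derivation of the form `x ↦ ∑ μ j i • (b i * x * b j) - x * w` forces `μ = 0` as soon as
`1` and the `b i` are linearly independent. -/
lemma eq_zero_of_derivation {n p : ℕ} {b : Fin p → Matrix (Fin n) (Fin n) ℂ}
    (hb : LinearIndependent ℂ (Fin.cons 1 b : Fin (p + 1) → Matrix (Fin n) (Fin n) ℂ))
    {μ : Fin p → Fin p → ℂ} {w : Matrix (Fin n) (Fin n) ℂ}
    {S : Matrix (Fin n) (Fin n) ℂ → Matrix (Fin n) (Fin n) ℂ}
    (hS : ∀ x, S x = ∑ i, ∑ j, μ j i • (b i * x * b j) - x * w)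
    (hder : ∀ x y, S x * y + x * S y - S (x * y) = 0) (i j : Fin p) : μ i j = 0 := by
  set B : Fin p → Matrix (Fin n) (Fin n) ℂ := fun i => ∑ j, μ j i • b j with hB
  have hS' (x) : S x = ∑ i, b i * x * B i - x * w := by
    simp only [hS, hB, Finset.mul_sum, mul_smul_comm]
  have hcomm (i : Fin p) (y) : B i * y - y * B i = 0 := by
    refine coeff_eq_zero_of_sum_mul_mul_eq_zero
      (C := Fin.cons (∑ i, b i * y * B i - w * y) fun i => B i * y - y * B i) hb
      (fun x => ?_) i.succ
    rw [Fin.sum_univ_succ, ← hder x y]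
    simp only [hS', Fin.cons_zero, Fin.cons_succ, mul_sub, sub_mul, Finset.sum_sub_distrib,
      Finset.mul_sum, Finset.sum_mul, mul_assoc, one_mul]
    abel
  obtain ⟨r, hr⟩ : B j ∈ Set.range (Matrix.scalar (Fin n)) :=
    Matrix.mem_range_scalar_iff_commute_single'.mpr fun k l => (sub_eq_zero.mp (hcomm j _)).symm
  refine Fintype.linearIndependent_iff.mp hb (Fin.cons (-r) fun i => μ i j) ?_ i.succ
  rw [Fin.sum_univ_succ]
  simp only [Fin.cons_zero, Fin.cons_succ]
  change -r • (1 : Matrix (Fin n) (Fin n) ℂ) + B j = 0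
  rw [← hr, Matrix.scalar_apply, ← Matrix.smul_one_eq_diagonal, neg_smul, neg_add_cancel]

/-- Remark after Theorem 2.1: under the M-relations, the operators
`R(x) = Σᵢ aᵢxbⁱ + cx` and `S(x) = Σ_{i,j} μ_{ji}(bⁱxbʲ − Σ_k ψ^{i,j}_k xb^k − λ^{ij}x)`
satisfy `R(R(x)y + xR(y)) − R(x)R(y) − R²(xy) = S(x)y + xS(y) − S(xy)`; in
particular `R` satisfies the homogeneous identity iff all `μ_{ij} = 0`. -/
theorem stmt_11 (n p : ℕ) (hn : 1 ≤ n) (hp : 1 ≤ p)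
    (a b : Fin p → Matrix (Fin n) (Fin n) ℂ) (c : Matrix (Fin n) (Fin n) ℂ)
    (ha : LinearIndependent ℂ (Fin.cons 1 a : Fin (p + 1) → Matrix (Fin n) (Fin n) ℂ))
    (hb : LinearIndependent ℂ (Fin.cons 1 b : Fin (p + 1) → Matrix (Fin n) (Fin n) ℂ))
    (φ : Fin p → Fin p → Fin p → ℂ) (μ : Fin p → Fin p → ℂ)
    (ψ : Fin p → Fin p → Fin p → ℂ) (Λ : Fin p → Fin p → ℂ)
    (t : Fin p → Fin p → ℂ)
    (hM : MRel n p a b c φ μ ψ Λ t)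
    (R S : Matrix (Fin n) (Fin n) ℂ → Matrix (Fin n) (Fin n) ℂ)
    (hR : ∀ x, R x = ∑ i, a i * x * b i + c * x)
    (hS : ∀ x, S x = ∑ i, ∑ j, μ j i • (b i * x * b j - ∑ k, ψ i j k • (x * b k) - Λ i j • x)) :
    (∀ x y, R (R x * y + x * R y) - R x * R y - R (R (x * y))
        = S x * y + x * S y - S (x * y)) ∧
    ((∀ x y, R (R x * y + x * R y) - R x * R y - R (R (x * y)) = 0) ↔
      ∀ i j, μ i j = 0) := by
  obtain ⟨haa, hbb, hba, hbc, hca⟩ := hM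
  have hid := operator_identity a b c φ ψ μ Λ t haa hbb hba hbc hca R S hR hS
  refine ⟨hid, fun h => ?_, fun h x y => ?_⟩
  · refine eq_zero_of_derivation (S := S) (w := ∑ i, ∑ j, μ j i • (b i * b j)) hb
      (fun x => ?_) fun x y => by rw [← hid, h]
    simp only [hS, hbb, smul_sub, Finset.sum_sub_distrib, Finset.mul_sum, mul_add, mul_smul_comm,
      smul_add, Finset.sum_add_distrib, mul_one, sub_sub]
  · rw [hid]
    simp [hS, h]
end

section
/- Let n, p ≥ 1 and let a₁,…,a_p, b¹,…,b^p, c ∈ Mat_n(ℂ) with {1, a₁,…,a_p} and {1, b¹,…,b^p} each linearly independent, such that the bilinear multiplication x∘y = Σ_{i=1}^p (a_i x bⁱ y + x a_i y bⁱ − a_i x y bⁱ) + x c y on Mat_n(ℂ) is associative, and suppose in addition a_i a_j = δ_{ij} a_i for all i, j. Then there exist complex numbers c₁,…,c_p, u₁,…,u_p, v₁,…,v_p and q_{ij} (for i ≠ j) such that the shifted matrices Bⁱ = bⁱ + c_i·1 satisfy BⁱBʲ = (u_i − q_{ij})Bⁱ + q_{ij}Bʲ + v_i·1 for all i ≠ j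 and (Bⁱ)² = u_iBⁱ + v_i·1 for all i, where moreover q_{ij}² = u_iq_{ij} + v_i and (u_i − q_{ij})² = u_j(u_i − q_{ij}) + v_j for all i ≠ j, and (q_{ik} − q_{jk})(q_{ik} − q_{ij}) = 0 for all pairwise distinct i, j, k. -/
section Extraction

variable {n : ℕ} {ι : Type*} [Fintype ι]

/-- If `∑ i, F i * x * H i` vanishes for every `x`, then so does every combination of the `H i`
with coefficients a fixed entry of the `F i`. -/
theorem sum_entry_smul_right_eq_zero {F H : ι → Matrix (Fin n) (Fin n) ℂ}
    (h : ∀ x, ∑ i, F i * x * H i = 0) (r s : Fin n) : ∑ i, F i r s • H i = 0 := by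
  ext k l
  have := congrFun (congrFun (h (Matrix.single s k 1)) r) l
  simpa [Matrix.sum_apply, Matrix.mul_apply, Matrix.single_apply, ite_and] using this

/-- If `∑ i, F i * x * H i` vanishes for every `x`, then so does every combination of the `F i`
with coefficients a fixed entry of the `H i`. -/
theorem sum_entry_smul_left_eq_zero {F H : ι → Matrix (Fin n) (Fin n) ℂ}
    (h : ∀ x, ∑ i, F i * x * H i = 0) (r s : Fin n) : ∑ i, H i r s • F i = 0 := by
  ext k l
  have := congrFun (congrFun (h (Matrix.single l r 1)) k) s
  simpa [Matrix.sum_apply, Matrix.mul_apply, Matrix.single_apply, ite_and, mul_comm] using this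

theorem eq_zero_of_sum_mul_mul_left {e F : ι → Matrix (Fin n) (Fin n) ℂ}
    (he : LinearIndependent ℂ e) (h : ∀ x, ∑ i, e i * x * F i = 0) (i : ι) : F i = 0 := by
  ext r s
  exact Fintype.linearIndependent_iff.1 he (fun i => F i r s)
    (sum_entry_smul_left_eq_zero h r s) i

theorem eq_zero_of_sum_mul_mul_right {e F : ι → Matrix (Fin n) (Fin n) ℂ}
    (he : LinearIndependent ℂ e) (h : ∀ x, ∑ i, F i * x * e i = 0) (i : ι) : F i = 0 := by
  ext r s
  exact Fintype.linearIndependent_iff.1 he (fun i => F i r s)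
    (sum_entry_smul_right_eq_zero h r s) i

theorem exists_eq_smul_one_of_forall_commute {X : Matrix (Fin n) (Fin n) ℂ}
    (h : ∀ y, X * y = y * X) : ∃ t : ℂ, X = t • 1 := by
  obtain ⟨t, ht⟩ := Matrix.mem_range_scalar_of_commute_single (M := X)
    (fun i j _ => (h (Matrix.single i j 1)).symm)
  exact ⟨t, by rw [← ht, Matrix.smul_one_eq_diagonal]; rfl⟩

end Extraction

section Coefficients

variable {A : Type*} [Ring A] [Algebra ℂ A] {p : ℕ}

theorem coeff_eq_zero_of_cons_one {e : Fin p → A}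
    (he : LinearIndependent ℂ (Fin.cons 1 e : Fin (p + 1) → A)) {w : ℂ} {f : Fin p → ℂ}
    (h : w • 1 + ∑ i, f i • e i = 0) : w = 0 ∧ ∀ i, f i = 0 := by
  have := Fintype.linearIndependent_iff.1 he (Fin.cons w f)
    (by simpa [Fin.sum_univ_succ] using h)
  exact ⟨by simpa using this 0, fun i => by simpa using this i.succ⟩

theorem linearIndependent_cons_one_add_smul_one {e : Fin p → A}
    (he : LinearIndependent ℂ (Fin.cons 1 e : Fin (p + 1) → A)) (s : Fin p → ℂ) :
    LinearIndependent ℂ (Fin.cons 1 (fun i => e i + s i • 1) : Fin (p + 1) → A) := by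
  rw [Fintype.linearIndependent_iff]
  intro g hg
  have h : (g 0 + ∑ i : Fin p, g i.succ * s i) • (1 : A) + ∑ i : Fin p, g i.succ • e i = 0 := by
    rw [← hg]
    simp [Fin.sum_univ_succ, smul_add, Finset.sum_add_distrib, add_smul, Finset.sum_smul, smul_smul]
    abel
  obtain ⟨h0, h1⟩ := coeff_eq_zero_of_cons_one he h
  intro i
  refine Fin.cases ?_ h1 i
  simpa [h1] using h0

theorem pair_coeff_eq_zero {e : Fin p → A}
    (he : LinearIndependent ℂ (Fin.cons 1 e : Fin (p + 1) → A)) {i j : Fin p} (hij : i ≠ j)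
    {w x y : ℂ} (h : w • 1 + x • e i + y • e j = 0) : w = 0 ∧ x = 0 ∧ y = 0 := by
  have := coeff_eq_zero_of_cons_one he (w := w) (f := Pi.single i x + Pi.single j y)
    (by simpa [add_smul, Finset.sum_add_distrib, Pi.single_apply, ← add_assoc] using h)
  have hi := this.2 i
  have hj := this.2 j
  simp [hij, hij.symm] at hi hj
  exact ⟨this.1, hi, hj⟩

theorem triple_coeff_eq_zero {e : Fin p → A}
    (he : LinearIndependent ℂ (Fin.cons 1 e : Fin (p + 1) → A)) {i j k : Fin p} (hik : i ≠ k)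
    (hjk : j ≠ k) {w x y z : ℂ} (h : w • 1 + x • e i + y • e j + z • e k = 0) : z = 0 := by
  have := coeff_eq_zero_of_cons_one he (w := w)
    (f := Pi.single i x + Pi.single j y + Pi.single k z)
    (by simpa [add_smul, Finset.sum_add_distrib, Pi.single_apply, ← add_assoc] using h)
  have hk := this.2 k
  simpa [Pi.single_apply, hik.symm, hjk.symm] using hk

/-- Associativity constraints on a multiplication table in which `B i * B j` only involves
`1`, `B i` and `B j`. -/
theorem normal_form_constraints {B : Fin p → A}
    (hB : LinearIndependent ℂ (Fin.cons 1 B : Fin (p + 1) → A))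
    {u v : Fin p → ℂ} {q γ : Fin p → Fin p → ℂ}
    (hij : ∀ i j, i ≠ j → B i * B j = (u i - q i j) • B i + q i j • B j + γ i j • 1)
    (hii : ∀ i, B i * B i = u i • B i + v i • 1) :
    (∀ i j, i ≠ j → γ i j = v i) ∧
      (∀ i j, i ≠ j → q i j ^ 2 = u i * q i j + v i) ∧
      (∀ i j, i ≠ j → (u i - q i j) ^ 2 = u j * (u i - q i j) + v j) ∧
      (∀ i j k, i ≠ j → j ≠ k → i ≠ k → (q i k - q j k) * (q i k - q i j) = 0) := by
  have left : ∀ i j, i ≠ j → γ i j = v i ∧ q i j ^ 2 = u i * q i j + v i := by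
    intro i j h
    have e := mul_assoc (B i) (B i) (B j)
    rw [hij i j h, hii i] at e
    simp only [add_mul, mul_add, smul_mul_assoc, mul_smul_comm, one_mul, mul_one, hij i j h,
      hii i] at e
    obtain ⟨-, e1, e2⟩ := pair_coeff_eq_zero hB h
      (w := (u i - q i j) * (v i - γ i j)) (x := (u i - q i j) * q i j + γ i j)
      (y := - v i - (u i - q i j) * q i j)
      (by linear_combination (norm := module) -e)
    exact ⟨by linear_combination e1 + e2, by linear_combination e2⟩
  have right : ∀ i j, i ≠ j → (u i - q i j) ^ 2 = u j * (u i - q i j) + v j := by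
    intro i j h
    have e := mul_assoc (B i) (B j) (B j)
    rw [hij i j h, hii j] at e
    simp only [add_mul, mul_add, smul_mul_assoc, mul_smul_comm, one_mul, mul_one, hij i j h,
      hii j] at e
    obtain ⟨-, e1, -⟩ := pair_coeff_eq_zero hB h
      (w := (u i - q i j - u j) * γ i j + q i j * v j)
      (x := (u i - q i j - u j) * (u i - q i j) - v j)
      (y := (u i - q i j - u j) * q i j + q i j * u j + γ i j)
      (by linear_combination (norm := module) e)
    linear_combination e1
  refine ⟨fun i j h => (left i j h).1, fun i j h => (left i j h).2, right, ?_⟩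
  intro i j k h1 h2 h3
  have e := mul_assoc (B i) (B j) (B k)
  rw [hij i j h1, hij j k h2] at e
  simp only [add_mul, mul_add, smul_mul_assoc, mul_smul_comm, one_mul, mul_one, hij i j h1,
    hij j k h2, hij i k h3] at e
  have e1 := triple_coeff_eq_zero hB h3 h2
    (w := (u i - q i j) * γ i k + q i j * γ j k - (u j - q j k) * γ i j - q j k * γ i k)
    (x := (u i - q i j) * (u i - q i k) - (u j - q j k) * (u i - q i j)
      - q j k * (u i - q i k) - γ j k)
    (y := q i j * (u j - q j k) - (u j - q j k) * q i j)
    (z := (u i - q i j) * q i k + q i j * q j k + γ i j - q j k * q i k)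
    (by linear_combination (norm := module) e)
  linear_combination e1 + (left i k h3).2 - (left i j h1).1

/-- Structure constants of `b` are constrained by the relations with orthogonal idempotents `a`. -/
theorem structure_constants_of_idempotents {a b : Fin p → A} {c : A}
    (ha : LinearIndependent ℂ (Fin.cons 1 a : Fin (p + 1) → A))
    (haa : ∀ i j, a i * a j = if i = j then a i else 0)
    {ψ : Fin p → Fin p → Fin p → ℂ} {t : Fin p → Fin p → ℂ}
    (hba : ∀ k l, b k * a l = (if k = l then b k + c else 0) + ∑ i, ψ i k l • a i + t k l • 1)
    (hca : ∀ l, c * a l = - ∑ i, (ψ i i l + t i l) • a i) :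
    (∀ i k l, k ≠ l → i ≠ l → ψ i k l = 0) ∧
      (∀ m k, m ≠ k → ψ m k m + ψ m k k = ψ m m m + t m m - t k k) := by
  have sum_mul_a : ∀ (f : Fin p → ℂ) m, (∑ i, f i • a i) * a m = f m • a m := by
    intro f m
    simp [Finset.sum_mul, haa]
  have key : ∀ k l, k ≠ l → t k l = 0 ∧ ∀ i, i ≠ l → ψ i k l = 0 := by
    intro k l h
    have e : b k * a l * a l = b k * a l := by rw [mul_assoc, haa, if_pos rfl]
    rw [hba, if_neg h, zero_add, add_mul, sum_mul_a, smul_mul_assoc, one_mul] at e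
    obtain ⟨e0, e1⟩ := coeff_eq_zero_of_cons_one ha (w := t k l)
      (f := fun i => ψ i k l - if i = l then ψ l k l + t k l else 0)
      (by
        simp only [sub_smul, Finset.sum_sub_distrib, ite_smul, zero_smul, Finset.sum_ite_eq',
          Finset.mem_univ, if_true]
        linear_combination (norm := module) -e)
    refine ⟨e0, fun i hi => ?_⟩
    simpa [hi] using e1 i
  refine ⟨fun i k l h => (key k l h).2 i, fun m k h => ?_⟩
  have e : b k * a k * a m = 0 := by rw [mul_assoc, haa, if_neg h.symm, mul_zero]
  have ebm : b k * a m = ψ m k m • a m := by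
    rw [hba, if_neg h.symm, (key k m h.symm).1, zero_smul, add_zero, zero_add]
    refine Finset.sum_eq_single m (fun i _ hi => ?_) (by simp)
    rw [(key k m h.symm).2 i hi, zero_smul]
  have ecm : c * a m = -((ψ m m m + t m m) • a m) := by
    rw [hca]
    congr 1
    refine Finset.sum_eq_single m (fun i _ hi => ?_) (by simp)
    rw [(key i m hi).1, (key i m hi).2 i hi, add_zero, zero_smul]
  rw [hba, if_pos rfl, add_mul, add_mul, add_mul, sum_mul_a, ebm, ecm, smul_mul_assoc,
    one_mul] at e
  have e1 := (pair_coeff_eq_zero ha h (w := 0)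
    (x := ψ m k m + ψ m k k - (ψ m m m + t m m - t k k)) (y := 0)
    (by linear_combination (norm := module) e)).2.1
  linear_combination e1

/-- The normal form of the algebra generated by `b`, obtained by a shift by scalars. -/
theorem exists_shifted_normal_form {a b : Fin p → A} {c : A}
    (ha : LinearIndependent ℂ (Fin.cons 1 a : Fin (p + 1) → A))
    (hb : LinearIndependent ℂ (Fin.cons 1 b : Fin (p + 1) → A))
    (haa : ∀ i j, a i * a j = if i = j then a i else 0)
    {ψ : Fin p → Fin p → Fin p → ℂ} {lam t : Fin p → Fin p → ℂ}
    (hbb : ∀ i k, b i * b k = lam i k • 1 + ∑ l, ψ i k l • b l)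
    (hba : ∀ k l, b k * a l = (if k = l then b k + c else 0) + ∑ i, ψ i k l • a i + t k l • 1)
    (hca : ∀ l, c * a l = - ∑ i, (ψ i i l + t i l) • a i) :
    ∃ (cs u v : Fin p → ℂ) (q : Fin p → Fin p → ℂ),
      (∀ i j, i ≠ j →
        (b i + cs i • 1) * (b j + cs j • 1)
          = (u i - q i j) • (b i + cs i • 1) + q i j • (b j + cs j • 1) + v i • 1) ∧
      (∀ i, (b i + cs i • 1) * (b i + cs i • 1) = u i • (b i + cs i • 1) + v i • 1) ∧
      (∀ i j, i ≠ j → q i j ^ 2 = u i * q i j + v i) ∧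
      (∀ i j, i ≠ j → (u i - q i j) ^ 2 = u j * (u i - q i j) + v j) ∧
      (∀ i j k, i ≠ j → j ≠ k → i ≠ k → (q i k - q j k) * (q i k - q i j) = 0) := by
  obtain ⟨hψ, hsum⟩ := structure_constants_of_idempotents ha haa hba hca
  have hdiag : ∀ i, b i * b i = lam i i • 1 + ψ i i i • b i := by
    intro i
    rw [hbb, Finset.sum_eq_single i (fun l _ hl => ?_) (by simp)]
    rw [hψ i i l hl.symm hl.symm, zero_smul]
  have hoff : ∀ i j, i ≠ j → b i * b j = lam i j • 1 + (ψ i j i • b i + ψ i j j • b j) := by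
    intro i j h
    rw [hbb, Fintype.sum_eq_add i j h (fun l hl => ?_)]
    rw [hψ i j l hl.2.symm hl.1.symm, zero_smul]
  have hij : ∀ i j, i ≠ j → (b i + t i i • 1) * (b j + t j j • 1)
      = ((ψ i i i + 2 * t i i) - (ψ i j j + t i i)) • (b i + t i i • 1)
        + (ψ i j j + t i i) • (b j + t j j • 1)
        + (lam i j + t i i * t j j - (ψ i i i + 2 * t i i - (ψ i j j + t i i)) * t i i
          - (ψ i j j + t i i) * t j j) • 1 := by
    intro i j h
    have hs : ψ i j i = ψ i i i + t i i - t j j - ψ i j j := by linear_combination hsum i j h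
    simp only [add_mul, mul_add, smul_mul_assoc, mul_smul_comm, one_mul, mul_one, hoff i j h, hs]
    module
  have hii : ∀ i, (b i + t i i • 1) * (b i + t i i • 1)
      = (ψ i i i + 2 * t i i) • (b i + t i i • 1)
        + (lam i i - t i i * (ψ i i i + t i i)) • 1 := by
    intro i
    simp only [add_mul, mul_add, smul_mul_assoc, mul_smul_comm, one_mul, mul_one, hdiag i]
    module
  obtain ⟨h1, h2, h3, h4⟩ := normal_form_constraints
    (linearIndependent_cons_one_add_smul_one hb fun i => t i i)
    (u := fun i => ψ i i i + 2 * t i i) (v := fun i => lam i i - t i i * (ψ i i i + t i i))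
    (q := fun i j => ψ i j j + t i i)
    (γ := fun i j => lam i j + t i i * t j j
      - (ψ i i i + 2 * t i i - (ψ i j j + t i i)) * t i i - (ψ i j j + t i i) * t j j) hij hii
  refine ⟨_, _, _, _, fun i j h => ?_, hii, h2, h3, h4⟩
  rw [← h1 i j h]
  exact hij i j h

end Coefficients

section Associativity

variable {n p : ℕ} {a b : Fin p → Matrix (Fin n) (Fin n) ℂ} {c : Matrix (Fin n) (Fin n) ℂ}
  {mc : Matrix (Fin n) (Fin n) ℂ → Matrix (Fin n) (Fin n) ℂ → Matrix (Fin n) (Fin n) ℂ}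

/-- The components of the associativity condition along `1` (at `y = 1`) and along `a k` in the
leftmost tensor factor. -/
theorem associator_components
    (ha : LinearIndependent ℂ (Fin.cons 1 a : Fin (p + 1) → Matrix (Fin n) (Fin n) ℂ))
    (hmc : ∀ x y, mc x y
      = ∑ i, (a i * x * b i * y + x * a i * y * b i - a i * x * y * b i) + x * c * y)
    (hassoc : ∀ x y z, mc (mc x y) z = mc x (mc y z))
    (haa : ∀ i j, a i * a j = if i = j then a i else 0) :
    (∀ z, ((∑ i, a i * b i) * c - c * ∑ i, a i * b i) * z
      + ∑ l, ((∑ i, a i * b i) * a l - a l * b l - a l * c + c * a l) * z * b l = 0) ∧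
    (∀ k y, ∃ P : Matrix (Fin n) (Fin n) ℂ, ∀ z, P * z
      + (y * b k + y * c - b k * y - c * y) * z * b k
      + ∑ l, (b k * a l * y - y * (b k * a l)) * z * b l
      + ∑ i, (y * a i - a i * y) * z * (b i * b k) = 0) := by
  set R : Matrix (Fin n) (Fin n) ℂ → Matrix (Fin n) (Fin n) ℂ :=
    fun x => ∑ i, a i * x * b i with hR
  have Radd : ∀ x y, R (x + y) = R x + R y := by
    intro x y
    simp [hR, mul_add, add_mul, Finset.sum_add_distrib]
  have Rsub : ∀ x y, R (x - y) = R x - R y := by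
    intro x y
    simp [hR, mul_sub, sub_mul, Finset.sum_sub_distrib]
  have hmc' : ∀ x y, mc x y = R x * y + x * (R y + c * y) - R (x * y) := by
    intro x y
    rw [hmc]
    simp only [hR, Finset.sum_add_distrib, Finset.sum_sub_distrib, Finset.sum_mul,
      Finset.mul_sum, mul_add, mul_assoc]
    abel
  have RR : ∀ x y, R (R x * y) = ∑ k, a k * x * (b k * y * b k) := by
    intro x y
    simp only [hR]
    refine Finset.sum_congr rfl fun k _ => ?_
    rw [Finset.sum_mul, Finset.mul_sum, Finset.sum_mul, Finset.sum_eq_single k _ (by simp)]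
    · simp only [← mul_assoc, haa, if_true]
    · intro i _ hi
      simp only [← mul_assoc, haa, if_neg hi.symm, zero_mul]
  have RR1 : ∀ x, R (R x) = ∑ k, a k * x * (b k * b k) := by
    intro x
    simpa using RR x 1
  have expand : ∀ y z, (R y + c * y) * (R z + c * z) - (R (mc y z) + c * mc y z) = 0 ∧
      ∀ k, b k * y * b k * z + (R y + c * y) * b k * z - y * b k * b k * z
        + b k * y * (R z + c * z) - y * b k * (R z + c * z)
        - b k * y * z * b k - (R y + c * y) * z * b k + y * b k * z * b k
        - b k * mc y z + mc y z * b k = 0 := by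
    intro y z
    have h := eq_zero_of_sum_mul_mul_left ha
      (F := Fin.cons ((R y + c * y) * (R z + c * z) - (R (mc y z) + c * mc y z))
        (fun k => b k * y * b k * z + (R y + c * y) * b k * z - y * b k * b k * z
        + b k * y * (R z + c * z) - y * b k * (R z + c * z)
        - b k * y * z * b k - (R y + c * y) * z * b k + y * b k * z * b k
        - b k * mc y z + mc y z * b k)) ?_
    · exact ⟨by simpa using h 0, fun k => by simpa using h k.succ⟩
    · intro x
      have e := sub_eq_zero.2 (hassoc x y z)
      rw [hmc' (mc x y) z, hmc' x (mc y z), hmc' x y] at e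
      simp only [Radd, Rsub, add_mul, sub_mul, RR, RR1] at e
      rw [mul_assoc (R x) y z, RR] at e
      rw [Fin.sum_univ_succ]
      simp only [Fin.cons_zero, Fin.cons_succ]
      rw [← e]
      simp only [hR, Finset.sum_add_distrib, Finset.sum_sub_distrib, Finset.sum_mul,
        mul_add, mul_sub, add_mul, one_mul, mul_assoc]
      abel
  constructor
  · intro z
    have e := (expand 1 z).1
    rw [hmc' 1 z] at e
    simp only [Radd, Rsub, one_mul, mul_one, RR] at e
    refine Eq.trans ?_ e
    simp only [hR, one_mul, Finset.sum_add_distrib, Finset.sum_sub_distrib, Finset.sum_mul,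
      Finset.mul_sum, mul_add, mul_sub, add_mul, sub_mul, mul_assoc]
    abel
  · intro k y
    refine ⟨b k * y * b k + (R y + c * y) * b k - y * b k * b k - y * b k * c - b k * R y,
      fun z => ?_⟩
    have e := (expand y z).2 k
    rw [hmc' y z] at e
    refine Eq.trans ?_ e
    simp only [hR, Finset.sum_sub_distrib, Finset.sum_mul,
      Finset.mul_sum, mul_add, mul_sub, add_mul, sub_mul, mul_assoc]
    abel

end Associativity

/-- Theorem 2.5: if the multiplication `x∘y = Σᵢ (aᵢxbⁱy + xaᵢybⁱ − aᵢxybⁱ) + xcy`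
on `Mat_n(ℂ)` is associative, `{1,a₁,…,a_p}`, `{1,b¹,…,b^p}` are linearly
independent and `aᵢa_j = δ_{ij}aᵢ`, then after a shift `Bⁱ = bⁱ + cᵢ·1` the algebra
generated by the `Bⁱ` has the normal form (3.19)–(3.23). -/
theorem stmt_13 (n p : ℕ) (hn : 1 ≤ n) (hp : 1 ≤ p)
    (a b : Fin p → Matrix (Fin n) (Fin n) ℂ) (c : Matrix (Fin n) (Fin n) ℂ)
    (ha : LinearIndependent ℂ (Fin.cons 1 a : Fin (p + 1) → Matrix (Fin n) (Fin n) ℂ))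
    (hb : LinearIndependent ℂ (Fin.cons 1 b : Fin (p + 1) → Matrix (Fin n) (Fin n) ℂ))
    (mc : Matrix (Fin n) (Fin n) ℂ → Matrix (Fin n) (Fin n) ℂ → Matrix (Fin n) (Fin n) ℂ)
    (hmc : ∀ x y, mc x y
      = ∑ i, (a i * x * b i * y + x * a i * y * b i - a i * x * y * b i) + x * c * y)
    (hassoc : ∀ x y z, mc (mc x y) z = mc x (mc y z))
    (haa : ∀ i j, a i * a j = if i = j then a i else 0) :
    ∃ (cs u v : Fin p → ℂ) (q : Fin p → Fin p → ℂ),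
      (∀ i j, i ≠ j →
        (b i + cs i • 1) * (b j + cs j • 1)
          = (u i - q i j) • (b i + cs i • 1) + q i j • (b j + cs j • 1) + v i • 1) ∧
      (∀ i, (b i + cs i • 1) * (b i + cs i • 1) = u i • (b i + cs i • 1) + v i • 1) ∧
      (∀ i j, i ≠ j → q i j ^ 2 = u i * q i j + v i) ∧
      (∀ i j, i ≠ j → (u i - q i j) ^ 2 = u j * (u i - q i j) + v j) ∧
      (∀ i j k, i ≠ j → j ≠ k → i ≠ k → (q i k - q j k) * (q i k - q i j) = 0) := by
  obtain ⟨h1, h2⟩ := associator_components ha hmc hassoc haa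
  have hbb : ∀ i k, b i * b k
      ∈ Submodule.span ℂ (Set.range (Fin.cons 1 b : Fin (p + 1) → Matrix (Fin n) (Fin n) ℂ)) := by
    intro i k
    by_contra hmem
    obtain ⟨f, hf, hker⟩ := Submodule.exists_le_ker_of_notMem hmem
    have hfb : ∀ m : Fin (p + 1), f ((Fin.cons 1 b : Fin (p + 1) → _) m) = 0 := fun m =>
      hker (Submodule.subset_span ⟨m, rfl⟩)
    have hf1 : f 1 = 0 := by simpa using hfb 0
    have hfb' : ∀ l, f (b l) = 0 := fun l => by simpa using hfb l.succ
    have hcomm : ∀ y, (∑ i, f (b i * b k) • a i) * y = y * ∑ i, f (b i * b k) • a i := by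
      intro y
      obtain ⟨P, hP⟩ := h2 k y
      ext r s
      have e := congrArg f (sum_entry_smul_right_eq_zero
        (ι := Unit ⊕ Unit ⊕ Fin p ⊕ Fin p)
        (F := Sum.elim (fun _ => P) (Sum.elim (fun _ => y * b k + y * c - b k * y - c * y)
          (Sum.elim (fun l => b k * a l * y - y * (b k * a l)) (fun i => y * a i - a i * y))))
        (H := Sum.elim (fun _ => 1) (Sum.elim (fun _ => b k)
          (Sum.elim b (fun i => b i * b k))))
        (fun z => by simpa [add_assoc] using hP z) r s)
      simp only [Fintype.sum_sum_type, Sum.elim_inl, Sum.elim_inr, map_add, map_sum, map_smul,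
        hf1, hfb', mul_zero, Finset.sum_const_zero, zero_add, map_zero, smul_eq_mul,
        Matrix.sub_apply, sub_mul, Finset.sum_sub_distrib, sub_eq_zero] at e
      simp only [Finset.sum_mul, Finset.mul_sum, Matrix.sum_apply, smul_mul_assoc,
        mul_smul_comm, Matrix.smul_apply, smul_eq_mul]
      simpa only [mul_comm] using e.symm
    obtain ⟨t, ht⟩ := exists_eq_smul_one_of_forall_commute hcomm
    exact hf ((coeff_eq_zero_of_cons_one ha (w := -t) (f := fun i => f (b i * b k))
      (by rw [ht]; module)).2 i)
  have hbb' : ∀ i k, ∃ g : Fin (p + 1) → ℂ, b i * b k = g 0 • 1 + ∑ l : Fin p, g l.succ • b l := by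
    intro i k
    obtain ⟨g, hg⟩ := (Submodule.mem_span_range_iff_exists_fun ℂ).1 (hbb i k)
    exact ⟨g, by rw [← hg, Fin.sum_univ_succ]; simp⟩
  choose g hg using hbb'
  have hba : ∀ k l, ∃ t : ℂ, b k * a l
      = (if k = l then b k + c else 0) + ∑ i, g i k l.succ • a i + t • 1 := by
    intro k l
    obtain ⟨t, ht⟩ := exists_eq_smul_one_of_forall_commute
      (X := b k * a l - (if k = l then b k + c else 0) - ∑ i, g i k l.succ • a i) (by
      intro y
      obtain ⟨P, hP⟩ := h2 k y
      have e := eq_zero_of_sum_mul_mul_right hb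
        (F := Fin.cons (P + ∑ i, g i k 0 • (y * a i - a i * y)) (fun l =>
          (if k = l then y * b k + y * c - b k * y - c * y else 0)
            + (b k * a l * y - y * (b k * a l)) + ∑ i, g i k l.succ • (y * a i - a i * y)))
        (fun z => by
          refine Eq.trans ?_ (hP z)
          rw [Fin.sum_univ_succ]
          simp only [Fin.cons_zero, Fin.cons_succ, hg, mul_add, Finset.mul_sum, add_mul,
            Finset.sum_mul, Finset.sum_add_distrib, mul_smul_comm, smul_mul_assoc, mul_one,
            ite_mul, zero_mul, Finset.sum_ite_eq, Finset.mem_univ, if_true]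
          rw [Finset.sum_comm]
          abel) l.succ
      simp only [Fin.cons_succ, smul_sub, Finset.sum_sub_distrib] at e
      rw [← sub_eq_zero]
      refine Eq.trans ?_ e
      simp only [mul_sub, sub_mul, Finset.sum_mul, Finset.mul_sum, smul_mul_assoc,
        mul_smul_comm]
      split_ifs
      · simp only [mul_add, add_mul]
        abel
      · simp only [mul_zero, zero_mul]
        abel)
    exact ⟨t, by rw [← ht]; abel⟩
  choose t ht using hba
  have hca : ∀ l, c * a l = - ∑ i, (g i i l.succ + t i l) • a i := by
    intro l
    have e := eq_zero_of_sum_mul_mul_right hb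
      (F := Fin.cons ((∑ i, a i * b i) * c - c * ∑ i, a i * b i)
        (fun l => (∑ i, a i * b i) * a l - a l * b l - a l * c + c * a l))
      (fun z => by simpa [Fin.sum_univ_succ] using h1 z) l.succ
    have e1 : (∑ i, a i * b i) * a l
        = a l * b l + a l * c + ∑ i, (g i i l.succ + t i l) • a i := by
      simp only [Finset.sum_mul, mul_assoc, ht, mul_add, Finset.mul_sum, mul_smul_comm, haa,
        mul_ite, mul_zero, mul_one, smul_ite, smul_zero, Finset.sum_add_distrib,
        Finset.sum_ite_eq, Finset.sum_ite_eq', Finset.mem_univ, if_true, add_smul]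
      abel
    rw [Fin.cons_succ, e1] at e
    rw [eq_neg_iff_add_eq_zero, ← e]
    abel
  exact exists_shifted_normal_form ha hb haa (ψ := fun i k l => g i k l.succ)
    (lam := fun i k => g i k 0) hg ht hca
end

section
/- Let p > 3 and let complex numbers u_i, v_i (1 ≤ i ≤ p) and q_{ij} (1 ≤ i ≠ j ≤ p) satisfy: q_{ij}² = u_iq_{ij} + v_i for all i ≠ j; (u_i − q_{ij})² = u_j(u_i − q_{ij}) + v_j for all i ≠ j; and (q_{ik} − q_{jk})(q_{ik} − q_{ij}) = 0 for all pairwise distinct i, j, k. If the set {u₁,…,u_p} contains at least 3 distinct values, then the data is regular: there exists τ ∈ ℂ such that q_{ij} = u_i + τ for all i ≠ j and v_i = τ² + u_iτ for all i. -/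
/-- A monic quadratic `x ^ 2 = u * x + v` is determined by two distinct roots. -/
lemma quadratic_coeffs_of_ne {u v x y : ℂ} (hxy : x ≠ y) (hx : x ^ 2 = u * x + v)
    (hy : y ^ 2 = u * y + v) : u = x + y ∧ v = -(x * y) := by
  have hu : u = x + y := by
    apply mul_left_cancel₀ (sub_ne_zero.mpr hxy)
    linear_combination hy - hx
  exact ⟨hu, by linear_combination -hx - x * hu⟩

/-- A root of a monic quadratic is one of two given roots with the right sum. -/
lemma quadratic_root_eq_or {u v x y : ℂ} (hx : x ^ 2 = u * x + v)
    (hy : y ^ 2 = u * y + v) : y = x ∨ y = u - x := by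
  have h : (y - x) * (y - (u - x)) = 0 := by linear_combination hy - hx
  rcases mul_eq_zero.mp h with h | h
  · exact Or.inl (sub_eq_zero.mp h)
  · exact Or.inr (sub_eq_zero.mp h)

/-- Two monic quadratics with different linear coefficients share at most one root. -/
lemma common_root_unique {u v u' v' x y : ℂ} (hu : u ≠ u') (hx : x ^ 2 = u * x + v)
    (hx' : x ^ 2 = u' * x + v') (hy : y ^ 2 = u * y + v) (hy' : y ^ 2 = u' * y + v') :
    x = y := by
  apply mul_left_cancel₀ (sub_ne_zero.mpr hu)
  linear_combination hx' - hx - hy' + hy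

section
variable {ι : Type*} {u v : ι → ℂ} {q : ι → ι → ℂ}

/-- Three quadratics forming a triangle `{a, b}, {b, c}, {a, c}` of root sets do not admit
a further index whose quadratic coincides with the first one. -/
lemma triangle_no_repeat
    (h1 : ∀ i j, i ≠ j → q i j ^ 2 = u i * q i j + v i)
    (h2 : ∀ i j, i ≠ j → (u i - q i j) ^ 2 = u j * (u i - q i j) + v j)
    (h3 : ∀ i j k, i ≠ j → j ≠ k → i ≠ k → (q i k - q j k) * (q i k - q i j) = 0)
    {i j k l : ι} {a b c : ℂ} (hij : i ≠ j) (hik : i ≠ k) (hil : i ≠ l) (hjl : j ≠ l)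
    (hkl : k ≠ l) (hab : a ≠ b) (hbc : b ≠ c) (hac : a ≠ c)
    (hi : u i = a + b ∧ v i = -(a * b)) (hj : u j = b + c ∧ v j = -(b * c))
    (hk : u k = a + c ∧ v k = -(a * c)) (hl : u l = a + b ∧ v l = -(a * b)) : False := by
  have shared : ∀ m n (t : ℂ), m ≠ n → u m ≠ u n → t ^ 2 = u m * t + v m →
      t ^ 2 = u n * t + v n → u m - q m n = t := fun m n t hmn hu ht ht' =>
    common_root_unique hu (by linear_combination h1 m n hmn) (h2 m n hmn) ht ht'
  obtain ⟨ui, vi⟩ := hi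
  obtain ⟨uj, vj⟩ := hj
  obtain ⟨uk, vk⟩ := hk
  obtain ⟨ul, vl⟩ := hl
  have nij : u i ≠ u j := fun h => hac (by linear_combination h - ui + uj)
  have nik : u i ≠ u k := fun h => hbc (by linear_combination h - ui + uk)
  have njl : u j ≠ u l := fun h => hac (by linear_combination -h - ul + uj)
  have nkl : u k ≠ u l := fun h => hbc (by linear_combination -h - ul + uk)
  have eij := shared i j b hij nij (by rw [ui, vi]; ring) (by rw [uj, vj]; ring)
  have eik := shared i k a hik nik (by rw [ui, vi]; ring) (by rw [uk, vk]; ring)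
  have ejl := shared j l b hjl njl (by rw [uj, vj]; ring) (by rw [ul, vl]; ring)
  have ekl := shared k l a hkl nkl (by rw [uk, vk]; ring) (by rw [ul, vl]; ring)
  have qij : q i j = a := by linear_combination ui - eij
  have qik : q i k = b := by linear_combination ui - eik
  have qjl : q j l = c := by linear_combination uj - ejl
  have qkl : q k l = c := by linear_combination uk - ekl
  have ha := h3 i j l hij hjl hil
  have hb := h3 i k l hik hkl hil
  have hne : q i l - c ≠ 0 := by
    have h := h1 i l hil
    rw [ui, vi] at h
    intro hc
    have hcc : (c - a) * (c - b) = 0 := by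
      rw [← sub_eq_zero.mp hc]; linear_combination h
    rcases mul_eq_zero.mp hcc with h | h
    · exact hac (sub_eq_zero.mp h).symm
    · exact hbc (sub_eq_zero.mp h).symm
  rw [qjl, qij] at ha
  rw [qkl, qik] at hb
  have ha' := (mul_eq_zero.mp ha).resolve_left hne
  have hb' := (mul_eq_zero.mp hb).resolve_left hne
  exact hab (by linear_combination hb' - ha')

/-- A triangle of root sets `{a, b}, {b, c}, {a, c}` cannot be extended by a fourth index. -/
lemma triangle_no_fourth
    (h1 : ∀ i j, i ≠ j → q i j ^ 2 = u i * q i j + v i)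
    (h2 : ∀ i j, i ≠ j → (u i - q i j) ^ 2 = u j * (u i - q i j) + v j)
    (h3 : ∀ i j k, i ≠ j → j ≠ k → i ≠ k → (q i k - q j k) * (q i k - q i j) = 0)
    {i j k l : ι} {a b c : ℂ} (hij : i ≠ j) (hik : i ≠ k) (hjk : j ≠ k) (hil : i ≠ l)
    (hjl : j ≠ l) (hkl : k ≠ l) (hab : a ≠ b) (hbc : b ≠ c) (hac : a ≠ c)
    (hi : u i = a + b ∧ v i = -(a * b)) (hj : u j = b + c ∧ v j = -(b * c))
    (hk : u k = a + c ∧ v k = -(a * c)) : False := by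
  have shared : ∀ m (x y : ℂ), m ≠ l → u m = x + y ∧ v m = -(x * y) →
      x ^ 2 = u l * x + v l ∨ y ^ 2 = u l * y + v l := by
    rintro m x y hml ⟨hu, hv⟩
    have hx : x ^ 2 = u m * x + v m := by rw [hu, hv]; ring
    have hr : (u m - q m l) ^ 2 = u m * (u m - q m l) + v m := by
      linear_combination h1 m l hml
    have hl := h2 m l hml
    rcases quadratic_root_eq_or hx hr with h | h
    · rw [h] at hl; exact Or.inl hl
    · rw [h, hu, add_sub_cancel_left] at hl; exact Or.inr hl
  have swap : ∀ {m : ι} {x y : ℂ}, u m = x + y ∧ v m = -(x * y) →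
      u m = y + x ∧ v m = -(y * x) := fun h =>
    ⟨by rw [h.1, add_comm], by rw [h.2, mul_comm]⟩
  have case_ab (ha : a ^ 2 = u l * a + v l) (hb : b ^ 2 = u l * b + v l) : False :=
    triangle_no_repeat h1 h2 h3 hij hik hil hjl hkl hab hbc hac hi hj hk
      (quadratic_coeffs_of_ne hab ha hb)
  have case_bc (hb : b ^ 2 = u l * b + v l) (hc : c ^ 2 = u l * c + v l) : False :=
    triangle_no_repeat h1 h2 h3 hjk hij.symm hjl hkl hil hbc hac.symm hab.symm
      hj (swap hk) (swap hi) (quadratic_coeffs_of_ne hbc hb hc)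
  have case_ac (ha : a ^ 2 = u l * a + v l) (hc : c ^ 2 = u l * c + v l) : False :=
    triangle_no_repeat h1 h2 h3 hjk.symm hik.symm hkl hjl hil hac hbc.symm hab
      hk (swap hj) hi (quadratic_coeffs_of_ne hac ha hc)
  rcases shared i a b hil hi with ha | hb
  · rcases shared j b c hjl hj with hb | hc
    · exact case_ab ha hb
    · exact case_ac ha hc
  · rcases shared k a c hkl hk with ha | hc
    · exact case_ab ha hb
    · exact case_bc hb hc

/-- If three quadratics with distinct `u` share the root `t`, so do all of them. -/
lemma common_root_of_three
    (h1 : ∀ i j, i ≠ j → q i j ^ 2 = u i * q i j + v i)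
    (h2 : ∀ i j, i ≠ j → (u i - q i j) ^ 2 = u j * (u i - q i j) + v j)
    {i j k : ι} {t : ℂ} (nij : u i ≠ u j) (nik : u i ≠ u k) (njk : u j ≠ u k)
    (hi : t ^ 2 = u i * t + v i) (hj : t ^ 2 = u j * t + v j) (hk : t ^ 2 = u k * t + v k)
    (l : ι) : t ^ 2 = u l * t + v l := by
  by_contra hl
  have other : ∀ m, t ^ 2 = u m * t + v m → (u m - t) ^ 2 = u l * (u m - t) + v l := by
    intro m hm
    have hml : m ≠ l := by rintro rfl; exact hl hm
    have hr : (u m - q m l) ^ 2 = u m * (u m - q m l) + v m := by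
      linear_combination h1 m l hml
    have h := h2 m l hml
    rcases quadratic_root_eq_or hm hr with h' | h'
    · rw [h'] at h; exact absurd h hl
    · rwa [h'] at h
  have e1 := (quadratic_coeffs_of_ne (fun h => nij (sub_left_injective h))
    (other i hi) (other j hj)).1
  have e2 := (quadratic_coeffs_of_ne (fun h => nik (sub_left_injective h))
    (other i hi) (other k hk)).1
  exact njk (by linear_combination e2 - e1)

/-- If all quadratics share the root `t` and `u` takes three values, the data is regular. -/
lemma regular_of_common_root
    (h1 : ∀ i j, i ≠ j → q i j ^ 2 = u i * q i j + v i)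
    (h2 : ∀ i j, i ≠ j → (u i - q i j) ^ 2 = u j * (u i - q i j) + v j)
    (h3 : ∀ i j k, i ≠ j → j ≠ k → i ≠ k → (q i k - q j k) * (q i k - q i j) = 0)
    (hdist : ∃ i j k, u i ≠ u j ∧ u i ≠ u k ∧ u j ≠ u k)
    {t : ℂ} (ht : ∀ l, t ^ 2 = u l * t + v l) (l m : ι) (hlm : l ≠ m) :
    q l m = u l - t := by
  have of_ne : ∀ m n, u m ≠ u n → q m n = u m - t := by
    intro m n hu
    have hmn : m ≠ n := fun h => hu (congrArg u h)
    have h : u m - q m n = t :=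
      common_root_unique hu (by linear_combination h1 m n hmn) (h2 m n hmn) (ht m) (ht n)
    linear_combination -h
  by_cases hu : u l = u m
  · obtain ⟨j, k, hj, hk, hjk⟩ : ∃ j k, u l ≠ u j ∧ u l ≠ u k ∧ u j ≠ u k := by
      obtain ⟨i, j, k, hij, hik, hjk⟩ := hdist
      by_cases hi : u l = u i
      · exact ⟨j, k, hi ▸ hij, hi ▸ hik, hjk⟩
      by_cases hj : u l = u j
      · exact ⟨i, k, hi, hj ▸ hjk, hik⟩
      · exact ⟨i, j, hi, hj, hij⟩
    have key : ∀ n, u l ≠ u n → q l m = u n - t ∨ q l m = u l - t := by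
      intro n hn
      have h := h3 l n m (fun h => hn (congrArg u h))
        (fun h => hn (hu.trans (congrArg u h).symm)) hlm
      rw [of_ne n m (hu ▸ hn.symm), of_ne l n hn] at h
      exact (mul_eq_zero.mp h).imp sub_eq_zero.mp sub_eq_zero.mp
    rcases key j hj with h | h
    · rcases key k hk with h' | h'
      · exact absurd (sub_left_injective (h.symm.trans h')) hjk
      · exact h'
    · exact h
  · exact of_ne l m hu

end

/-- Proposition 2.1: for `p > 3`, if the structure constants `u, v, q` of the algebra
`B` satisfy the associativity identities and `{u₁,…,u_p}` takes at least three
distinct values, then the algebra is regular: `q_{ij} = u_i + τ` and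
`v_i = τ² + u_iτ` for some `τ`. -/
theorem stmt_14 (p : ℕ) (hp : 3 < p)
    (u v : Fin p → ℂ) (q : Fin p → Fin p → ℂ)
    (h1 : ∀ i j, i ≠ j → q i j ^ 2 = u i * q i j + v i)
    (h2 : ∀ i j, i ≠ j → (u i - q i j) ^ 2 = u j * (u i - q i j) + v j)
    (h3 : ∀ i j k, i ≠ j → j ≠ k → i ≠ k → (q i k - q j k) * (q i k - q i j) = 0)
    (hdist : ∃ i j k, u i ≠ u j ∧ u i ≠ u k ∧ u j ≠ u k) :
    ∃ τ : ℂ, (∀ i j, i ≠ j → q i j = u i + τ) ∧ (∀ i, v i = τ ^ 2 + u i * τ) := by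
  obtain ⟨t, ht⟩ : ∃ t : ℂ, ∀ l, t ^ 2 = u l * t + v l := by
    obtain ⟨i, j, k, nij, nik, njk⟩ := hdist
    have hij : i ≠ j := fun h => nij (congrArg u h)
    have hik : i ≠ k := fun h => nik (congrArg u h)
    have hjk : j ≠ k := fun h => njk (congrArg u h)
    have own : ∀ m n, m ≠ n → (u m - q m n) ^ 2 = u m * (u m - q m n) + v m :=
      fun m n hmn => by linear_combination h1 m n hmn
    have bi := own i j hij
    have bj := h2 i j hij
    have ai := own i k hik
    have ak := h2 i k hik
    have cj := own j k hjk
    have ck := h2 j k hjk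
    generalize u i - q i j = b at bi bj
    generalize u i - q i k = a at ai ak
    generalize u j - q j k = c at cj ck
    by_cases hab : a = b
    · subst hab
      exact ⟨a, common_root_of_three h1 h2 nij nik njk bi bj ak⟩
    by_cases hbc : b = c
    · subst hbc
      exact ⟨b, common_root_of_three h1 h2 nij nik njk bi bj ck⟩
    by_cases hac : a = c
    · subst hac
      exact ⟨a, common_root_of_three h1 h2 nij nik njk ai cj ak⟩
    obtain ⟨l, hl⟩ : ∃ l, l ∉ ({i, j, k} : Finset (Fin p)) := by
      by_contra! h
      have hcard := Finset.card_le_card (fun x _ => h x : Finset.univ ⊆ {i, j, k})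
      rw [Finset.card_univ, Fintype.card_fin] at hcard
      have := Finset.card_le_three (a := i) (b := j) (c := k)
      omega
    simp only [Finset.mem_insert, Finset.mem_singleton, not_or] at hl
    exact (triangle_no_fourth h1 h2 h3 hij hik hjk (Ne.symm hl.1) (Ne.symm hl.2.1)
      (Ne.symm hl.2.2) hab hbc hac (quadratic_coeffs_of_ne hab ai bi)
      (quadratic_coeffs_of_ne hbc bj cj) (quadratic_coeffs_of_ne hac ak ck)).elim
  refine ⟨-t, fun i j hij => ?_, fun i => by linear_combination -ht i⟩
  rw [regular_of_common_root h1 h2 h3 hdist ht i j hij, sub_eq_add_neg]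
end

section
/- Let V₁,…,V_r be finite-dimensional complex vector spaces with dim V_i = m_i, and let A = End(V₁) ⊕ ⋯ ⊕ End(V_r). Let L be a finite-dimensional complex vector space equipped with a right A-module structure, containing A as a vector subspace in such a way that the module action restricted to elements of A ⊆ L is right multiplication in the algebra A, and suppose dim L = 2·dim A. Suppose further that L carries a nondegenerate symmetric bilinear form (·,·) satisfying (v, a₁a₂) = (v a₁, a₂) for all v ∈ L and a₁, a₂ ∈ A, and (a₁, a₂) = 0 for all a₁, a₂ ∈ A. Then L is isomorphic as a right A-module to ⊕_{i=1}^r (V_i^*)^{2m_i}, where V_i^* denotes the dual space of V_i with its natural right End(V_i)-action (the summands End(V_j) for j ≠ i acting by zero). -/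
open Module

/-- The element of `∀ i, End(Vᵢ)` supported at `i`, where it is `z ↦ φ z • w`. -/
noncomputable def piRankOne {n : Type*} [DecidableEq n] {V : n → Type*}
    [∀ i, AddCommGroup (V i)] [∀ i, Module ℂ (V i)] (i : n) :
    Dual ℂ (V i) →ₗ[ℂ] V i →ₗ[ℂ] (∀ j, Module.End ℂ (V j)) :=
  (LinearMap.smulRightₗ (R := ℂ) (M₂ := V i) (M := V i)).compr₂
    (LinearMap.single ℂ (fun j => Module.End ℂ (V j)) i)

section piRankOne

variable {n : Type*} [DecidableEq n] {V : n → Type*}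
  [∀ i, AddCommGroup (V i)] [∀ i, Module ℂ (V i)]

theorem piRankOne_eq_single (i : n) (φ : Dual ℂ (V i)) (w : V i) :
    piRankOne i φ w = Pi.single i (LinearMap.smulRight φ w) := rfl

theorem mul_piRankOne (i : n) (φ : Dual ℂ (V i)) (w : V i) (x : ∀ j, Module.End ℂ (V j)) :
    x * piRankOne i φ w = piRankOne i φ (x i w) := by
  rw [piRankOne_eq_single, piRankOne_eq_single, ← Pi.single_mul_right]
  congr 1
  ext z
  simp

theorem piRankOne_mul (i : n) (φ : Dual ℂ (V i)) (w : V i) (x : ∀ j, Module.End ℂ (V j)) :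
    piRankOne i φ w * x = piRankOne i (φ.comp (x i)) w := by
  rw [piRankOne_eq_single, piRankOne_eq_single, ← Pi.single_mul_left]
  congr 1

theorem piRankOne_mul_piRankOne (i : n) (φ ψ : Dual ℂ (V i)) (w u : V i) :
    piRankOne i φ w * piRankOne i ψ u = φ u • piRankOne i ψ w := by
  rw [mul_piRankOne, ← map_smul]
  simp [piRankOne_eq_single]

theorem one_eq_sum_piRankOne [Fintype n] [∀ i, FiniteDimensional ℂ (V i)] :
    (1 : ∀ j, Module.End ℂ (V j)) =
      ∑ i, ∑ k, piRankOne i ((finBasis ℂ (V i)).coord k) (finBasis ℂ (V i) k) := by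
  have h (i : n) : (1 : Module.End ℂ (V i)) =
      ∑ k, LinearMap.smulRight ((finBasis ℂ (V i)).coord k) (finBasis ℂ (V i) k) := by
    ext z
    simp [Basis.sum_repr]
  rw [← Finset.univ_sum_single (1 : ∀ j, Module.End ℂ (V j))]
  refine Finset.sum_congr rfl fun i _ => ?_
  simp only [piRankOne_eq_single]
  rw [Pi.one_apply, h i]
  exact map_sum (LinearMap.single ℂ (fun j => Module.End ℂ (V j)) i) _ _

end piRankOne

/-- A vector and a functional pairing to `1`, or anything if the space is trivial. -/
theorem exists_dual_apply_smul_eq_self (W : Type*) [AddCommGroup W] [Module ℂ W] :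
    ∃ (φ : Dual ℂ W) (u : W), ∀ w : W, φ u • w = w := by
  rcases subsingleton_or_nontrivial W with h | h
  · exact ⟨0, 0, fun w => Subsingleton.elim _ _⟩
  · obtain ⟨u, hu⟩ := exists_ne (0 : W)
    obtain ⟨φ, hφ⟩ := Projective.exists_dual_ne_zero ℂ hu
    refine ⟨(φ u)⁻¹ • φ, u, fun w => ?_⟩
    simp [inv_mul_cancel₀ hφ]

/-- An isotropic subspace of half the dimension is its own orthogonal complement. -/
theorem mem_range_of_forall_apply_eq_zero {A L : Type*} [AddCommGroup A] [Module ℂ A]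
    [AddCommGroup L] [Module ℂ L] [FiniteDimensional ℂ L]
    (ι : A →ₗ[ℂ] L) (hι : Function.Injective ι) (hdimL : finrank ℂ L = 2 * finrank ℂ A)
    (Bf : L →ₗ[ℂ] L →ₗ[ℂ] ℂ) (hsymm : ∀ v w : L, Bf v w = Bf w v)
    (hnd : ∀ v : L, (∀ w, Bf v w = 0) → v = 0)
    (hAA : ∀ x y : A, Bf (ι x) (ι y) = 0) {v : L} (hv : ∀ y, Bf v (ι y) = 0) :
    v ∈ LinearMap.range ι := by
  have hB : LinearMap.BilinForm.Nondegenerate Bf :=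
    ⟨hnd, fun w h => hnd w fun z => by rw [hsymm, h]⟩
  have hle : LinearMap.range ι ≤ LinearMap.BilinForm.orthogonal Bf (LinearMap.range ι) := by
    rintro _ ⟨x, rfl⟩ _ ⟨y, rfl⟩
    exact hAA y x
  have hrank := LinearMap.BilinForm.finrank_orthogonal hB (LinearMap.range ι)
  rw [LinearMap.finrank_range_of_inj hι] at hrank
  rw [Submodule.eq_of_le_of_finrank_eq hle
    (by rw [hrank, LinearMap.finrank_range_of_inj hι]; omega)]
  rintro _ ⟨y, rfl⟩
  exact (hsymm _ _).trans (hv y)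

/-- The multiplicity space of `Vᵢ*` in `L`, cut out by a rank-one idempotent, has dimension at
most `2 dim Vᵢ`. -/
theorem finrank_range_act_piRankOne_le {n : Type*} [DecidableEq n] {V : n → Type*}
    [∀ i, AddCommGroup (V i)] [∀ i, Module ℂ (V i)] [∀ i, FiniteDimensional ℂ (V i)]
    {L : Type*} [AddCommGroup L] [Module ℂ L] [FiniteDimensional ℂ L]
    (act : L →ₗ[ℂ] (∀ i, Module.End ℂ (V i)) →ₗ[ℂ] L)
    (hact : ∀ (v : L) (x y : ∀ i, Module.End ℂ (V i)), act (act v x) y = act v (x * y))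
    (ι : (∀ i, Module.End ℂ (V i)) →ₗ[ℂ] L)
    (hιact : ∀ x y : ∀ i, Module.End ℂ (V i), act (ι x) y = ι (x * y))
    (Bf : L →ₗ[ℂ] L →ₗ[ℂ] ℂ)
    (hinv : ∀ (v : L) (x y : ∀ i, Module.End ℂ (V i)),
      Bf v (ι (x * y)) = Bf (act v x) (ι y))
    (hperp : ∀ v : L, (∀ y, Bf v (ι y) = 0) → v ∈ LinearMap.range ι)
    (i : n) (φ : Dual ℂ (V i)) (u : V i) (hφ : ∀ w : V i, φ u • w = w) :
    finrank ℂ (LinearMap.range (act.flip (piRankOne i φ u))) ≤ 2 * finrank ℂ (V i) := by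
  set M := LinearMap.range (act.flip (piRankOne i φ u))
  have hfix : ∀ v ∈ M, act v (piRankOne i φ u) = v := by
    rintro _ ⟨v, rfl⟩
    rw [LinearMap.flip_apply, hact, piRankOne_mul_piRankOne, ← map_smul, hφ]
  let R : Dual ℂ (V i) →ₗ[ℂ] (∀ j, Module.End ℂ (V j)) :=
    LinearMap.flip (piRankOne (V := V) i) u
  let F : M →ₗ[ℂ] Dual ℂ (Dual ℂ (V i)) := (Bf.compl₂ (ι.comp R)).comp M.subtype
  let G : V i →ₗ[ℂ] L := ι.comp (piRankOne i φ)
  have hker : (LinearMap.ker F).map M.subtype ≤ LinearMap.range G := by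
    rintro _ ⟨⟨v, hv⟩, hvF, rfl⟩
    obtain ⟨x, rfl⟩ := hperp v fun y => by
      rw [← hfix v hv, ← hinv, piRankOne_mul]
      exact LinearMap.congr_fun (LinearMap.mem_ker.mp hvF) (φ.comp (y i))
    refine ⟨x i u, ?_⟩
    rw [Submodule.subtype_apply]
    exact (congrArg ι (mul_piRankOne i φ u x).symm).trans ((hιact _ _).symm.trans (hfix _ hv))
  have h1 := F.finrank_range_add_finrank_ker
  have h2 : finrank ℂ (LinearMap.range F) ≤ finrank ℂ (V i) := by
    simpa [Subspace.dual_finrank_eq] using Submodule.finrank_le (LinearMap.range F)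
  have h3 : finrank ℂ (LinearMap.ker F) ≤ finrank ℂ (V i) := by
    rw [← Submodule.finrank_map_subtype_eq M (LinearMap.ker F)]
    exact (Submodule.finrank_mono hker).trans G.finrank_range_le
  omega


/-- Lemma 4.1: if `A = End(V₁) ⊕ ⋯ ⊕ End(V_r)` and `L` is a right `A`-module
(given by `act`) containing `A` (via `ι`) with the module action extending right
multiplication, `dim L = 2·dim A`, and `L` carries a nondegenerate symmetric
invariant bilinear form vanishing on `A`, then `L ≅ ⊕ᵢ (Vᵢ*)^{2mᵢ}` as a right
`A`-module. -/
theorem stmt_17 (r : ℕ) (hr : 1 ≤ r) (V : Fin r → Type*)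
    [∀ i, AddCommGroup (V i)] [∀ i, Module ℂ (V i)] [∀ i, FiniteDimensional ℂ (V i)]
    (mdim : Fin r → ℕ) (hdim : ∀ i, Module.finrank ℂ (V i) = mdim i)
    (L : Type*) [AddCommGroup L] [Module ℂ L] [FiniteDimensional ℂ L]
    (act : L →ₗ[ℂ] (∀ i, Module.End ℂ (V i)) →ₗ[ℂ] L)
    (hact : ∀ (v : L) (x y : ∀ i, Module.End ℂ (V i)), act (act v x) y = act v (x * y))
    (hact1 : ∀ v : L, act v 1 = v)
    (ι : (∀ i, Module.End ℂ (V i)) →ₗ[ℂ] L) (hι : Function.Injective ι)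
    (hιact : ∀ x y : ∀ i, Module.End ℂ (V i), act (ι x) y = ι (x * y))
    (hdimL : Module.finrank ℂ L = 2 * Module.finrank ℂ (∀ i, Module.End ℂ (V i)))
    (Bf : L →ₗ[ℂ] L →ₗ[ℂ] ℂ)
    (hsymm : ∀ v w : L, Bf v w = Bf w v)
    (hnd : ∀ v : L, (∀ w, Bf v w = 0) → v = 0)
    (hinv : ∀ (v : L) (x y : ∀ i, Module.End ℂ (V i)),
      Bf v (ι (x * y)) = Bf (act v x) (ι y))
    (hAA : ∀ x y : ∀ i, Module.End ℂ (V i), Bf (ι x) (ι y) = 0) :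
    ∃ e : L ≃ₗ[ℂ] (∀ i, Fin (2 * mdim i) → Module.Dual ℂ (V i)),
      ∀ (v : L) (x : ∀ i, Module.End ℂ (V i)),
        e (act v x) = fun i k => (e v i k).comp (x i) := by
  choose φ u hφ using fun i => exists_dual_apply_smul_eq_self (V i)
  let M := fun i => LinearMap.range (act.flip (piRankOne i (φ i) (u i)))
  have hM (i) : finrank ℂ (M i) ≤ finrank ℂ (Fin (2 * mdim i) → ℂ) := by
    rw [finrank_fin_fun, ← hdim i]
    exact finrank_range_act_piRankOne_le act hact ι hιact Bf hinv
      (fun v hv => mem_range_of_forall_apply_eq_zero ι hι hdimL Bf hsymm hnd hAA hv) i _ _ (hφ i)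
  choose J hJ using fun i => finrank_le_iff_exists_linearMap.mp (hM i)
  have hmem (i) (v : L) (w : V i) : act v (piRankOne i (φ i) w) ∈ M i := by
    refine ⟨act v (piRankOne i (φ i) w), ?_⟩
    rw [LinearMap.flip_apply, hact, piRankOne_mul_piRankOne, ← map_smul, hφ]
  let T (i) : L →ₗ[ℂ] V i →ₗ[ℂ] M i := LinearMap.mk₂ ℂ (fun v w => ⟨_, hmem i v w⟩)
    (fun _ _ _ => Subtype.ext (by simp)) (fun _ _ _ => Subtype.ext (by simp))
    (fun _ _ _ => Subtype.ext (by simp)) (fun _ _ _ => Subtype.ext (by simp))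
  let e₀ : L →ₗ[ℂ] (∀ i, Fin (2 * mdim i) → Dual ℂ (V i)) :=
    LinearMap.pi fun i => LinearMap.pi fun k => (T i).compr₂ ((LinearMap.proj k).comp (J i))
  have hinj : Function.Injective e₀ := by
    rw [injective_iff_map_eq_zero]
    intro v hv
    have hT (i) (w : V i) : act v (piRankOne i (φ i) w) = 0 := by
      refine congrArg Subtype.val (?_ : T i v w = 0)
      refine (injective_iff_map_eq_zero (J i)).mp (hJ i) _ (funext fun k => ?_)
      exact LinearMap.congr_fun (congrFun (congrFun hv i) k) w
    have hall (i) (ψ : Dual ℂ (V i)) (w : V i) : act v (piRankOne i ψ w) = 0 := by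
      rw [← hφ i w, map_smul, ← piRankOne_mul_piRankOne, ← hact, hT, map_zero,
        LinearMap.zero_apply]
    rw [← hact1 v, one_eq_sum_piRankOne]
    simp [hall]
  have hrank : finrank ℂ L = finrank ℂ (∀ i, Fin (2 * mdim i) → Dual ℂ (V i)) := by
    rw [hdimL, finrank_pi_fintype, finrank_pi_fintype, Finset.mul_sum]
    refine Finset.sum_congr rfl fun i _ => ?_
    rw [finrank_linearMap, finrank_pi_fintype]
    simp [Subspace.dual_finrank_eq, hdim, mul_assoc]
  refine ⟨LinearEquiv.ofInjectiveOfFinrankEq e₀ hinj hrank, fun v x => ?_⟩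
  funext i k
  ext w
  have hTx : T i (act v x) w = T i v (x i w) := Subtype.ext (by
    change act (act v x) (piRankOne i (φ i) w) = act v (piRankOne i (φ i) (x i w))
    rw [hact, mul_piRankOne])
  exact congrArg (fun z => J i z k) hTx
end
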